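/- arXiv:1907.04588 — 3 statements merged into one kernel-verified Lean document; each statement's English description precedes it below -/
import Mathlib

section
/- For all positive integers m and n with m ≡ 2 (mod 12) and n ≡ 2 (mod 4), there exists a (2,n)-regular (m,n,3,2,1)-OOSPC with 5n(m−2)/24 codewords. -/
open Finset

/-- An (m,n,k,lamA,lamC)-OOSPC: a family of k-subsets of Z_m x Z_n with
auto-correlation at most lamA and cross-correlation at most lamC. -/
def OOSPC (m n k lamA lamC : ℕ) (F : Finset (Finset (ZMod m × ZMod n))) : Prop :=
  (∀ X ∈ F, X.card = k) ∧
  (∀ X ∈ F, ∀ g : ZMod m × ZMod n, g ≠ 0 →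
    (X ∩ X.image (fun x => g + x)).card ≤ lamA) ∧
  (∀ X ∈ F, ∀ Y ∈ F, X ≠ Y → ∀ g : ZMod m × ZMod n,
    (X ∩ Y.image (fun x => g + x)).card ≤ lamC)

/-- The leave of a family: nonzero elements of Z_m x Z_n not occurring as a
difference of two elements of a member of the family. -/
def leave (m n : ℕ) (F : Finset (Finset (ZMod m × ZMod n))) : Set (ZMod m × ZMod n) :=
  {g | g ≠ 0 ∧ ∀ X ∈ F, ∀ x ∈ X, ∀ y ∈ X, x - y ≠ g}

/-- (s,t)-regularity: the leave together with 0 equals S × T, where S and T are the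
unique subgroups of order s of Z_m and of order t of Z_n (for s ∣ m, t ∣ n these are
exactly the elements killed by s, resp. t). -/
def Regular (m n s t : ℕ) (F : Finset (Finset (ZMod m × ZMod n))) : Prop :=
  insert (0 : ZMod m × ZMod n) (leave m n F) =
    {p : ZMod m × ZMod n | s • p.1 = 0 ∧ t • p.2 = 0}

/-- ξ: the number of subgroups of order 3 in Z_m × Z_n. -/
def xi (m n : ℕ) : ℕ := if 3 ∣ m ∧ 3 ∣ n then 4 else if 3 ∣ m * n then 1 else 0

/-- ω = 0 if lamA = 2, and ω = ξ if lamA = 3. -/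
def omega (lamA m n : ℕ) : ℕ := if lamA = 2 then 0 else xi m n

/-- The pairs `(a i, a i + i)` with `1 ≤ i ≤ s` cover `1, …, 2s`, where `a i + i` may stand
for `4s + 1 - (a i + i)`. Skolem sequences and hooked Skolem sequences have this property. -/
def SkolemCover (s : ℕ) (a : ℕ → ℕ) : Prop :=
  ∀ p, 1 ≤ p → p ≤ 2 * s →
    ∃ i, 1 ≤ i ∧ i ≤ s ∧ (a i = p ∨ a i + i = p ∨ a i + i + p = 4 * s + 1)

lemma exists_of_eq {P : ℕ → Prop} (w : ℕ) (h : ∀ i, i = w → P i) : ∃ i, P i := ⟨w, h w rfl⟩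

lemma exists_skolemCover_four_mul (t : ℕ) : ∃ a, SkolemCover (4 * t) a := by
  refine ⟨fun i => if i % 2 = 0 then 6 * t - i / 2 else if i = 1 then t
    else if i = 4 * t - 1 then 2 * t + 1 else if i = 2 * t - 1 then 2 * t
    else if i = 2 * t + 1 then t - 1 else if i < 2 * t then t + 1 + (2 * t - 1 - i) / 2
    else (4 * t - 1 - i) / 2, ?_⟩
  intro p hp hp'
  obtain h | h | h | h | h | h | h | h | h | h :
    (4 * t ≤ p ∧ p < 6 * t) ∨ 6 * t < p ∨ (p = 6 * t ∨ p = 2 * t + 1) ∨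
    (1 < t ∧ (p = 2 * t ∨ p = 4 * t - 1)) ∨ (1 < t ∧ (p = t - 1 ∨ p = 3 * t)) ∨
    (p = t ∨ p = t + 1) ∨
    p + 2 ≤ t ∨ (3 * t < p ∧ p + 2 ≤ 4 * t) ∨ (t + 2 ≤ p ∧ p < 2 * t) ∨
    (2 * t + 2 ≤ p ∧ p < 3 * t) := by omega
  · exact exists_of_eq (2 * (6 * t - p)) fun i hi => ⟨by omega, by omega, by grind⟩
  · exact exists_of_eq (2 * (p - 6 * t)) fun i hi => ⟨by omega, by omega, by grind⟩
  · exact exists_of_eq (4 * t - 1) fun i hi => ⟨by omega, by omega, by grind⟩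
  · exact exists_of_eq (2 * t - 1) fun i hi => ⟨by omega, by omega, by grind⟩
  · exact exists_of_eq (2 * t + 1) fun i hi => ⟨by omega, by omega, by grind⟩
  · exact exists_of_eq 1 fun i hi => ⟨by omega, by omega, by grind⟩
  · exact exists_of_eq (4 * t - 1 - 2 * p) fun i hi => ⟨by omega, by omega, by grind⟩
  · exact exists_of_eq (2 * p + 1 - 4 * t) fun i hi => ⟨by omega, by omega, by grind⟩
  · exact exists_of_eq (4 * t + 1 - 2 * p) fun i hi => ⟨by omega, by omega, by grind⟩
  · exact exists_of_eq (2 * p - 4 * t - 1) fun i hi => ⟨by omega, by omega, by grind⟩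

lemma exists_skolemCover_four_mul_add_one (t : ℕ) : ∃ a, SkolemCover (4 * t + 1) a := by
  by_cases ht : t = 1
  · subst ht
    refine ⟨![0, 8, 1, 4, 2, 5] ∘ Fin.ofNat 6, ?_⟩
    intro p hp hp'
    have : ∀ p ∈ Icc 1 10, ∃ i ∈ Icc 1 5, (![0, 8, 1, 4, 2, 5] ∘ Fin.ofNat 6) i = p ∨
        (![0, 8, 1, 4, 2, 5] ∘ Fin.ofNat 6) i + i = p := by decide
    obtain ⟨i, hi, h⟩ := this p (by simp; omega)
    exact ⟨i, (mem_Icc.1 hi).1, (mem_Icc.1 hi).2, by tauto⟩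
  refine ⟨fun i => if i % 2 = 0 then 6 * t + 2 - i / 2 else if i = 4 * t + 1 then 2 * t + 1
    else if i = 1 then t + 1 else if i = 2 * t - 1 then 2 * t + 2
    else if i < 2 * t then t + 2 + (2 * t - 1 - i) / 2 else (4 * t + 1 - i) / 2, ?_⟩
  intro p hp hp'
  obtain h | h | h | h | h | h | h | h | h :
    (4 * t + 2 ≤ p ∧ p < 6 * t + 2) ∨ 6 * t + 2 < p ∨ (p = 2 * t + 1 ∨ p = 6 * t + 2) ∨
    (1 ≤ t ∧ (p = t + 1 ∨ p = t + 2)) ∨ (1 ≤ t ∧ (p = 2 * t + 2 ∨ p = 4 * t + 1)) ∨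
    (t + 3 ≤ p ∧ p ≤ 2 * t) ∨ (2 * t + 3 ≤ p ∧ p ≤ 3 * t) ∨ p ≤ t ∨
    (3 * t + 1 ≤ p ∧ p ≤ 4 * t) := by omega
  · exact exists_of_eq (2 * (6 * t + 2 - p)) fun i hi => ⟨by omega, by omega, by grind⟩
  · exact exists_of_eq (2 * (p - 6 * t - 2)) fun i hi => ⟨by omega, by omega, by grind⟩
  · exact exists_of_eq (4 * t + 1) fun i hi => ⟨by omega, by omega, by grind⟩
  · exact exists_of_eq 1 fun i hi => ⟨by omega, by omega, by grind⟩
  · exact exists_of_eq (2 * t - 1) fun i hi => ⟨by omega, by omega, by grind⟩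
  · exact exists_of_eq (4 * t + 3 - 2 * p) fun i hi => ⟨by omega, by omega, by grind⟩
  · exact exists_of_eq (2 * p - 4 * t - 3) fun i hi => ⟨by omega, by omega, by grind⟩
  · exact exists_of_eq (4 * t + 1 - 2 * p) fun i hi => ⟨by omega, by omega, by grind⟩
  · exact exists_of_eq (2 * p - 4 * t - 1) fun i hi => ⟨by omega, by omega, by grind⟩

lemma exists_skolemCover_four_mul_add_two (t : ℕ) : ∃ a, SkolemCover (4 * t + 2) a := by
  refine ⟨fun i => if i = 4 * t + 2 then 4 * t + 3 else if i % 2 = 0 then (4 * t + 2 - i) / 2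
    else if i = 4 * t + 1 then 2 * t + 1 else if i = 2 * t + 1 then 4 * t + 2
    else if i = 1 then 7 * t + 3
    else if i < 2 * t then 5 * t + 2 + (2 * t + 1 - i) / 2
    else 4 * t + 3 + (4 * t + 1 - i) / 2, ?_⟩
  intro p hp hp'
  obtain h | h | h | h | h | h | h | h | h | h :
    p ≤ 2 * t ∨ (2 * t + 2 ≤ p ∧ p ≤ 4 * t + 1) ∨ (p = 2 * t + 1 ∨ p = 6 * t + 2) ∨
    (1 ≤ t ∧ (p = 4 * t + 2 ∨ p = 6 * t + 3)) ∨ (p = 4 * t + 3 ∨ p = 8 * t + 4) ∨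
    (1 ≤ t ∧ (p = 7 * t + 3 ∨ p = 7 * t + 4)) ∨ (4 * t + 4 ≤ p ∧ p ≤ 5 * t + 2) ∨
    (7 * t + 5 ≤ p ∧ p ≤ 8 * t + 3) ∨ (5 * t + 3 ≤ p ∧ p ≤ 6 * t + 1) ∨
    (6 * t + 4 ≤ p ∧ p ≤ 7 * t + 2) := by omega
  · exact exists_of_eq (4 * t + 2 - 2 * p) fun i hi => ⟨by omega, by omega, by grind⟩
  · exact exists_of_eq (2 * p - 4 * t - 2) fun i hi => ⟨by omega, by omega, by grind⟩
  · exact exists_of_eq (4 * t + 1) fun i hi => ⟨by omega, by omega, by grind⟩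
  · exact exists_of_eq (2 * t + 1) fun i hi => ⟨by omega, by omega, by grind⟩
  · exact exists_of_eq (4 * t + 2) fun i hi => ⟨by omega, by omega, by grind⟩
  · exact exists_of_eq 1 fun i hi => ⟨by omega, by omega, by grind⟩
  · exact exists_of_eq (4 * t + 1 - 2 * (p - 4 * t - 3)) fun i hi => ⟨by omega, by omega, by grind⟩
  · exact exists_of_eq (2 * (p - 4 * t - 3) - 4 * t - 1) fun i hi => ⟨by omega, by omega, by grind⟩
  · exact exists_of_eq (2 * t + 1 - 2 * (p - 5 * t - 2)) fun i hi => ⟨by omega, by omega, by grind⟩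
  · exact exists_of_eq (2 * (p - 5 * t - 2) - 2 * t - 1) fun i hi => ⟨by omega, by omega, by grind⟩

lemma exists_skolemCover_four_mul_sub_one (t : ℕ) (ht : 1 ≤ t) :
    ∃ a, SkolemCover (4 * t - 1) a := by
  refine ⟨fun i => if i = 4 * t - 2 then 2 * t + 1 else if i % 2 = 0 then 6 * t - 1 - i / 2
    else if i = 1 then t else if i = 4 * t - 1 then 4 * t else if i = 2 * t - 1 then 2 * t
    else if i = 2 * t + 1 then t - 1 else if i < 2 * t then t + 1 + (2 * t - 1 - i) / 2
    else (4 * t - 1 - i) / 2, ?_⟩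
  intro p hp hp'
  obtain h | h | h | h | h | h | h | h | h | h | h :
    p + 2 ≤ t ∨ (3 * t < p ∧ p + 2 ≤ 4 * t) ∨ (t + 2 ≤ p ∧ p < 2 * t) ∨
    (2 * t + 2 ≤ p ∧ p < 3 * t) ∨ (2 ≤ t ∧ (p = t - 1 ∨ p = 3 * t)) ∨ (p = t ∨ p = t + 1) ∨
    (2 ≤ t ∧ (p = 2 * t ∨ p = 4 * t - 1)) ∨ (p = 2 * t + 1 ∨ p = 6 * t - 1) ∨
    (p = 4 * t ∨ p = 8 * t - 2) ∨ (4 * t + 1 ≤ p ∧ p ≤ 6 * t - 2) ∨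
    (6 * t ≤ p ∧ p ≤ 8 * t - 3) := by omega
  · exact exists_of_eq (4 * t - 1 - 2 * p) fun i hi => ⟨by omega, by omega, by grind⟩
  · exact exists_of_eq (2 * p + 1 - 4 * t) fun i hi => ⟨by omega, by omega, by grind⟩
  · exact exists_of_eq (4 * t + 1 - 2 * p) fun i hi => ⟨by omega, by omega, by grind⟩
  · exact exists_of_eq (2 * p - 4 * t - 1) fun i hi => ⟨by omega, by omega, by grind⟩
  · exact exists_of_eq (2 * t + 1) fun i hi => ⟨by omega, by omega, by grind⟩
  · exact exists_of_eq 1 fun i hi => ⟨by omega, by omega, by grind⟩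
  · exact exists_of_eq (2 * t - 1) fun i hi => ⟨by omega, by omega, by grind⟩
  · exact exists_of_eq (4 * t - 2) fun i hi => ⟨by omega, by omega, by grind⟩
  · exact exists_of_eq (4 * t - 1) fun i hi => ⟨by omega, by omega, by grind⟩
  · exact exists_of_eq (2 * (6 * t - 1 - p)) fun i hi => ⟨by omega, by omega, by grind⟩
  · exact exists_of_eq (2 * (p + 1 - 6 * t)) fun i hi => ⟨by omega, by omega, by grind⟩

lemma exists_skolemCover (s : ℕ) : ∃ a, SkolemCover s a := by
  obtain h | h | h | h : s = 4 * (s / 4) ∨ s = 4 * (s / 4) + 1 ∨ s = 4 * (s / 4) + 2 ∨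
    s = 4 * (s / 4 + 1) - 1 := by omega
  all_goals rw [h]
  · exact exists_skolemCover_four_mul _
  · exact exists_skolemCover_four_mul_add_one _
  · exact exists_skolemCover_four_mul_add_two _
  · exact exists_skolemCover_four_mul_sub_one _ (by omega)

/-- A cyclic difference family: `s` zero-sum triples of integers which, up to sign, represent all
nonzero residues modulo `6s + 1`. -/
lemma exists_zeroSum_triples (s : ℕ) : ∃ k : Fin s → Fin 3 → ℤ, (∀ i, ∑ r, k i r = 0) ∧
    ∀ d : ℤ, ¬ (6 * s + 1 : ℤ) ∣ d →
      ∃ i r, (6 * s + 1 : ℤ) ∣ d - k i r ∨ (6 * s + 1 : ℤ) ∣ d + k i r := by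
  obtain ⟨a, ha⟩ := exists_skolemCover s
  refine ⟨fun i => ![(i : ℤ) + 1, a (i + 1) + s, -(a (i + 1) + s + (i + 1))], fun i => ?_, ?_⟩
  · simp [Fin.sum_univ_three]
    ring
  have small : ∀ p : ℕ, 1 ≤ p → p ≤ 3 * s → ∃ i : Fin s, ∃ r,
      (6 * s + 1 : ℤ) ∣ p - ![(i : ℤ) + 1, a (i + 1) + s, -(a (i + 1) + s + (i + 1))] r ∨
      (6 * s + 1 : ℤ) ∣ p + ![(i : ℤ) + 1, a (i + 1) + s, -(a (i + 1) + s + (i + 1))] r := by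
    intro p hp hp'
    by_cases hps : p ≤ s
    · refine ⟨⟨p - 1, by omega⟩, 0, Or.inl ?_⟩
      simp [Nat.cast_sub hp]
    obtain ⟨i, hi, his, h⟩ := ha (p - s) (by omega) (by omega)
    obtain ⟨i, rfl⟩ := Nat.exists_eq_add_of_le' hi
    obtain h | h | h := h
    · exact ⟨⟨i, his⟩, 1, Or.inl ⟨0, by simp; omega⟩⟩
    · exact ⟨⟨i, his⟩, 2, Or.inr ⟨0, by simp; omega⟩⟩
    · exact ⟨⟨i, his⟩, 2, Or.inl ⟨1, by simp; omega⟩⟩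
  intro d hd
  have h0 := Int.emod_nonneg d (by positivity : (6 * s + 1 : ℤ) ≠ 0)
  have h1 := Int.emod_lt_of_pos d (by positivity : (0 : ℤ) < 6 * s + 1)
  have h2 : d % (6 * s + 1) ≠ 0 := fun h => hd (Int.dvd_of_emod_eq_zero h)
  have h3 : (6 * s + 1 : ℤ) ∣ d - d % (6 * s + 1) := Int.dvd_self_sub_emod
  by_cases hle : d % (6 * s + 1) ≤ 3 * s
  · obtain ⟨i, r, h⟩ := small (d % (6 * s + 1)).toNat (by omega) (by omega)
    rw [Int.toNat_of_nonneg h0] at h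
    refine ⟨i, r, h.imp (fun h => ?_) fun h => ?_⟩
    · exact (dvd_add h3 h).trans (dvd_of_eq (by ring))
    · exact (dvd_add h3 h).trans (dvd_of_eq (by ring))
  · obtain ⟨i, r, h⟩ := small (6 * s + 1 - d % (6 * s + 1)).toNat (by omega) (by omega)
    rw [Int.toNat_of_nonneg (by omega)] at h
    refine ⟨i, r, h.symm.imp (fun h => ?_) fun h => ?_⟩
    · exact (dvd_add (dvd_sub h3 h) (dvd_refl _)).trans (dvd_of_eq (by ring))
    · exact (dvd_add (dvd_sub h3 h) (dvd_refl _)).trans (dvd_of_eq (by ring))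

/-- The slots of a system of codewords indexed by `(J × Fin 3) ⊕ (J × Fin 2)`: a codeword
`{0, a, 2a}` of the first kind has the differences `±a, ±2a`, one of the second kind the differences
`±x₀, ±x₁, ±x₂`. -/
abbrev Slot (J : Type*) := (J × Fin 3) × Bool × Bool ⊕ (J × Fin 2) × Fin 3 × Bool

section Codewords

variable {G J : Type*} [AddCommGroup G] (e : Fin 3 → G) (K : J → Fin 3 → G)

/-- The codeword `{0, a, 2a}` with `a = e r + K j r`, or the codeword `{0, x₀, -x₂}` with
`x r = e r + K j (r + 1 + b)`. -/
def nonzeroPoints : (J × Fin 3) ⊕ (J × Fin 2) → G × G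
  | .inl (j, r) => (e r + K j r, (2 : ℤ) • K j r)
  | .inr (j, b) => (e 0 + K j (0 + 1 + b.castSucc), -(e 2 + K j (2 + 1 + b.castSucc)))

/-- The codeword with the given index. -/
def codeword [DecidableEq G] (c : (J × Fin 3) ⊕ (J × Fin 2)) : Finset G :=
  {0, (nonzeroPoints e K c).1, (nonzeroPoints e K c).2}

/-- The difference in a given slot. -/
def slotDiff : Slot J → G
  | .inl ((j, r), d, n) => (if n then (-1 : ℤ) else 1) • if d then (2 : ℤ) • K j r else e r + K j r
  | .inr ((j, b), r, n) => (if n then (-1 : ℤ) else 1) • (e r + K j (r + 1 + b.castSucc))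

/-- The codeword to which a slot belongs. -/
def slotOwner : Slot J → (J × Fin 3) ⊕ (J × Fin 2) := Sum.map Prod.fst Prod.fst

variable {e K}

lemma exists_slot_neg (σ : Slot J) :
    ∃ τ, slotOwner τ = slotOwner σ ∧ slotDiff e K τ = -slotDiff e K σ := by
  obtain ⟨⟨j, r⟩, d, n⟩ | ⟨⟨j, b⟩, r, n⟩ := σ
  · refine ⟨.inl ((j, r), d, !n), rfl, ?_⟩
    cases n <;> simp only [slotDiff, Bool.not_true, Bool.not_false, if_true, if_false,
      Bool.false_eq_true, neg_zsmul, one_zsmul, neg_neg]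
  · refine ⟨.inr ((j, b), r, !n), rfl, ?_⟩
    cases n <;> simp only [slotDiff, Bool.not_true, Bool.not_false, if_true, if_false,
      Bool.false_eq_true, neg_zsmul, one_zsmul, neg_neg]

lemma sub_nonzeroPoints_inl (he : ∀ r, (2 : ℤ) • e r = 0) (j : J) (r : Fin 3) :
    (nonzeroPoints e K (.inl (j, r))).1 - (nonzeroPoints e K (.inl (j, r))).2 =
      -(e r + K j r) := by
  have h := he r
  simp only [nonzeroPoints]
  linear_combination (norm := abel) h

lemma sub_nonzeroPoints_inr (he' : ∑ r, e r = 0) (hK : ∀ j, ∑ r, K j r = 0) (j : J) (b : Fin 2) :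
    (nonzeroPoints e K (.inr (j, b))).1 - (nonzeroPoints e K (.inr (j, b))).2 =
      -(e 1 + K j (1 + 1 + b.castSucc)) := by
  have h : e 0 + e 1 + e 2 = 0 := by rw [← he', Fin.sum_univ_three]
  have hk : K j (0 + 1 + b.castSucc) + K j (1 + 1 + b.castSucc) + K j (2 + 1 + b.castSucc)
      = 0 := by
    rw [← hK j, Fin.sum_univ_three]
    fin_cases b
    · change K j 1 + K j 2 + K j 0 = _
      abel
    · change K j 2 + K j 0 + K j 1 = _
      abel
  simp only [nonzeroPoints]
  linear_combination (norm := abel) h + hk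

lemma exists_slot (he : ∀ r, (2 : ℤ) • e r = 0) (he' : ∑ r, e r = 0)
    (hK : ∀ j, ∑ r, K j r = 0) (c : (J × Fin 3) ⊕ (J × Fin 2)) :
    ∃ σ τ υ, slotOwner σ = c ∧ slotOwner τ = c ∧ slotOwner υ = c ∧ σ ≠ τ ∧
      slotDiff e K σ = (nonzeroPoints e K c).1 ∧ slotDiff e K τ = -(nonzeroPoints e K c).2 ∧
      slotDiff e K υ = (nonzeroPoints e K c).1 - (nonzeroPoints e K c).2 := by
  obtain ⟨j, r⟩ | ⟨j, b⟩ := c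
  · rw [sub_nonzeroPoints_inl he]
    exact ⟨.inl ((j, r), false, false), .inl ((j, r), true, true), .inl ((j, r), false, true),
      rfl, rfl, rfl, by simp, by simp [slotDiff, nonzeroPoints],
      by simp [slotDiff, nonzeroPoints],
      by simp only [slotDiff, if_true, if_false, Bool.false_eq_true, neg_zsmul, one_zsmul]⟩
  · rw [sub_nonzeroPoints_inr he' hK]
    exact ⟨.inr ((j, b), 0, false), .inr ((j, b), 2, false), .inr ((j, b), 1, true),
      rfl, rfl, rfl, by simp, by simp [slotDiff, nonzeroPoints],
      by simp [slotDiff, nonzeroPoints], by simp only [slotDiff, if_true, neg_zsmul, one_zsmul]⟩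

lemma exists_slot_of_ne [DecidableEq G] (he : ∀ r, (2 : ℤ) • e r = 0) (he' : ∑ r, e r = 0)
    (hK : ∀ j, ∑ r, K j r = 0) {c : (J × Fin 3) ⊕ (J × Fin 2)} {x y : G}
    (hx : x ∈ codeword e K c) (hy : y ∈ codeword e K c) (hxy : x ≠ y) :
    ∃ σ, slotOwner σ = c ∧ slotDiff e K σ = x - y := by
  obtain ⟨σ, τ, υ, hσ, hτ, hυ, -, dσ, dτ, dυ⟩ := exists_slot he he' hK c
  obtain ⟨σ', hσ', dσ'⟩ := exists_slot_neg (e := e) (K := K) σ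
  obtain ⟨τ', hτ', dτ'⟩ := exists_slot_neg (e := e) (K := K) τ
  obtain ⟨υ', hυ', dυ'⟩ := exists_slot_neg (e := e) (K := K) υ
  simp only [codeword, mem_insert, mem_singleton] at hx hy
  grind

lemma exists_sub_eq_slotDiff [DecidableEq G] (he' : ∑ r, e r = 0)
    (hK : ∀ j, ∑ r, K j r = 0) (σ : Slot J) :
    ∃ x ∈ codeword e K (slotOwner σ), ∃ y ∈ codeword e K (slotOwner σ),
      x - y = slotDiff e K σ := by
  have key : ∀ (c : (J × Fin 3) ⊕ (J × Fin 2)) (g : G), g = (nonzeroPoints e K c).1 ∨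
      g = -(nonzeroPoints e K c).2 ∨ g = -((nonzeroPoints e K c).1 - (nonzeroPoints e K c).2) ∨
      g = (nonzeroPoints e K c).2 →
      ∀ n : Bool, ∃ x ∈ codeword e K c, ∃ y ∈ codeword e K c,
        x - y = (if n then (-1 : ℤ) else 1) • g := by
    intro c g hg n
    suffices h : ∃ x ∈ codeword e K c, ∃ y ∈ codeword e K c, x - y = g by
      obtain ⟨x, hx, y, hy, rfl⟩ := h
      cases n
      · exact ⟨x, hx, y, hy, by simp⟩
      · exact ⟨y, hy, x, hx, by simp⟩
    simp only [codeword, mem_insert, mem_singleton]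
    obtain rfl | rfl | rfl | rfl := hg
    · exact ⟨_, .inr (.inl rfl), 0, .inl rfl, sub_zero _⟩
    · exact ⟨0, .inl rfl, _, .inr (.inr rfl), zero_sub _⟩
    · exact ⟨_, .inr (.inr rfl), _, .inr (.inl rfl), (neg_sub _ _).symm⟩
    · exact ⟨_, .inr (.inr rfl), 0, .inl rfl, sub_zero _⟩
  obtain ⟨⟨j, r⟩, d, n⟩ | ⟨⟨j, b⟩, r, n⟩ := σ
  · refine key _ _ ?_ n
    cases d
    · exact .inl rfl
    · exact .inr (.inr (.inr rfl))
  · refine key (.inr (j, b)) (e r + K j (r + 1 + b.castSucc)) ?_ n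
    rw [sub_nonzeroPoints_inr he' hK, neg_neg]
    fin_cases r
    · exact .inl rfl
    · exact .inr (.inr (.inl rfl))
    · exact .inr (.inl (neg_neg _).symm)

theorem slotDiff_injective_and_image_eq [Fintype J] [DecidableEq G] (M : Finset G)
    (hM : 24 * Fintype.card J ≤ #M)
    (hcov : ∀ g ∈ M, ∃ j r, (g = (2 : ℤ) • K j r ∨ g = -((2 : ℤ) • K j r)) ∨
      ∃ r', g = e r' + K j r ∨ g = -(e r' + K j r)) :
    Function.Injective (slotDiff e K) ∧ univ.image (slotDiff e K) = M := by
  classical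
  have hsub : M ⊆ univ.image (slotDiff e K) := by
    intro g hg
    rw [mem_image]
    obtain ⟨j, r, (rfl | rfl) | ⟨r', h⟩⟩ := hcov g hg
    · exact ⟨.inl ((j, r), true, false), mem_univ _, by simp [slotDiff]⟩
    · exact ⟨.inl ((j, r), true, true), mem_univ _, by simp [slotDiff]⟩
    · obtain ⟨n, hn⟩ : ∃ n : Bool, g = (if n then (-1 : ℤ) else 1) • (e r' + K j r) := by
        obtain h | h := h
        · exact ⟨false, by simp [h]⟩
        · exact ⟨true, by rw [h, if_pos rfl, neg_one_zsmul]⟩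
      have hr : ∀ r r' : Fin 3, r = r' ∨ ∃ b : Fin 2, r = r' + 1 + b.castSucc := by decide
      obtain rfl | ⟨b, rfl⟩ := hr r r'
      · exact ⟨.inl ((j, r), false, n), mem_univ _, by simp [slotDiff, hn]⟩
      · exact ⟨.inr ((j, b), r', n), mem_univ _, hn.symm⟩
  have hcard : Fintype.card (Slot J) = 24 * Fintype.card J := by
    simp [Slot]; ring
  have hle : #(univ.image (slotDiff e K)) ≤ #M := by
    refine card_image_le.trans ?_
    rw [card_univ, hcard]; exact hM
  have heq := eq_of_subset_of_card_le hsub hle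
  refine ⟨?_, heq.symm⟩
  rw [← Set.injOn_univ, ← coe_univ, ← card_image_iff]
  refine le_antisymm card_image_le ?_
  rw [← heq, card_univ, hcard]; exact hM

lemma card_inter_translate_le_two [DecidableEq G] {p q g : G} (hq : q ≠ 0)
    (hpq : p ≠ -q) (hp2 : p ≠ -p) (hq2 : q ≠ -q) (hg : g ≠ 0) :
    #(({0, p, q} : Finset G) ∩ ({0, p, q} : Finset G).image (g + ·)) ≤ 2 := by
  by_contra! h
  have hsub : ({0, p, q} : Finset G) ∩ ({0, p, q} : Finset G).image (g + ·) = {0, p, q} :=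
    eq_of_subset_of_card_le inter_subset_left (card_le_three.trans h)
  have hmem : ∀ x ∈ ({0, p, q} : Finset G), x - g ∈ ({0, p, q} : Finset G) := by
    intro x hx
    rw [← hsub, mem_inter, mem_image] at hx
    obtain ⟨-, y, hy, rfl⟩ := hx
    simpa using hy
  simp only [mem_insert, mem_singleton, forall_eq_or_imp, forall_eq] at hmem
  simp only [zero_sub, neg_eq_zero, sub_eq_self, hg, false_or] at hmem
  clear h hsub
  grind

lemma card_inter_translate_le_one [DecidableEq G] {X Y : Finset G}
    (h : ∀ x ∈ X, ∀ x' ∈ X, ∀ y ∈ Y, ∀ y' ∈ Y, x ≠ x' → x - x' ≠ y - y') (g : G) :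
    #(X ∩ Y.image (g + ·)) ≤ 1 := by
  rw [card_le_one]
  intro x hx x' hx'
  simp only [mem_inter, mem_image] at hx hx'
  obtain ⟨hx, y, hy, rfl⟩ := hx
  obtain ⟨hx', y', hy', rfl⟩ := hx'
  by_contra hne
  exact h _ hx _ hx' y hy y' hy' hne (by abel)

lemma nonzeroPoints_ne [DecidableEq G] (he : ∀ r, (2 : ℤ) • e r = 0) (he' : ∑ r, e r = 0)
    (hK : ∀ j, ∑ r, K j r = 0) (hinj : Function.Injective (slotDiff e K))
    (h2 : ∀ σ, (2 : ℤ) • slotDiff e K σ ≠ 0) (c : (J × Fin 3) ⊕ (J × Fin 2)) :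
    let p := (nonzeroPoints e K c).1
    let q := (nonzeroPoints e K c).2
    p ≠ 0 ∧ q ≠ 0 ∧ p ≠ q ∧ p ≠ -q ∧ p ≠ -p ∧ q ≠ -q := by
  obtain ⟨σ, τ, υ, -, -, -, hne, dσ, dτ, dυ⟩ := exists_slot he he' hK c
  have hσ := h2 σ
  have hτ := h2 τ
  have hυ := h2 υ
  have hστ := hinj.ne hne
  rw [dσ] at hσ
  rw [dτ] at hτ
  rw [dυ] at hυ
  rw [dσ, dτ] at hστ
  grind

lemma eq_of_sub_eq_sub [DecidableEq G] (he : ∀ r, (2 : ℤ) • e r = 0) (he' : ∑ r, e r = 0)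
    (hK : ∀ j, ∑ r, K j r = 0) (hinj : Function.Injective (slotDiff e K))
    {c d : (J × Fin 3) ⊕ (J × Fin 2)} {x x' y y' : G} (hx : x ∈ codeword e K c)
    (hx' : x' ∈ codeword e K c) (hy : y ∈ codeword e K d) (hy' : y' ∈ codeword e K d)
    (hne : x ≠ x') (h : x - x' = y - y') : c = d := by
  have hne' : y ≠ y' := fun h' => hne (sub_eq_zero.1 (by rw [h, h', sub_self]))
  obtain ⟨σ, rfl, hσ⟩ := exists_slot_of_ne he he' hK hx hx' hne
  obtain ⟨τ, rfl, hτ⟩ := exists_slot_of_ne he he' hK hy hy' hne'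
  rw [hinj (hσ.trans (h.trans hτ.symm))]

end Codewords

/-- The point `(2u, 2v)` of `Z_m × Z_n`. -/
def evenPoint (m n : ℕ) (u v : ℤ) : ZMod m × ZMod n := ((2 * u : ℤ), (2 * v : ℤ))

lemma evenPoint_eq {a b : ℕ} {u u' v v' : ℤ} (hu : (a : ℤ) ∣ u - u') (hv : (b : ℤ) ∣ v - v') :
    evenPoint (2 * a) (2 * b) u v = evenPoint (2 * a) (2 * b) u' v' := by
  refine Prod.ext ?_ ?_ <;> refine ((ZMod.intCast_eq_intCast_iff_dvd_sub _ _ _).2 ?_).symm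
  · rw [← mul_sub, Nat.cast_mul]
    exact mul_dvd_mul_left _ hu
  · rw [← mul_sub, Nat.cast_mul]
    exact mul_dvd_mul_left _ hv

lemma neg_evenPoint (m n : ℕ) (u v : ℤ) : -evenPoint m n u v = evenPoint m n (-u) (-v) := by
  ext <;> simp [evenPoint]

lemma two_zsmul_evenPoint (m n : ℕ) (u v : ℤ) :
    (2 : ℤ) • evenPoint m n u v = evenPoint m n (2 * u) (2 * v) := by
  ext <;> simp [evenPoint]

/-- The involutions of `Z_{2a} × Z_{2b}` for odd `a` and `b`. -/
def involution (a b : ℕ) : Fin 3 → ZMod (2 * a) × ZMod (2 * b) :=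
  ![((a : ℤ), (0 : ℤ)), ((0 : ℤ), (b : ℤ)), ((a : ℤ), (b : ℤ))]

lemma two_mul_self_eq_zero (a : ℕ) : (2 * a : ZMod (2 * a)) = 0 := by
  exact_mod_cast ZMod.natCast_self (2 * a)

lemma two_zsmul_involution (a b : ℕ) (r : Fin 3) : (2 : ℤ) • involution a b r = 0 := by
  fin_cases r <;> ext <;> simp [involution, two_mul_self_eq_zero]

lemma sum_involution (a b : ℕ) : ∑ r, involution a b r = 0 := by
  rw [Fin.sum_univ_three]
  ext <;> simp [involution, ← two_mul, two_mul_self_eq_zero]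

lemma exists_eq_evenPoint {a b : ℕ} (ha : Odd a) (hb : Odd b) (g : ZMod (2 * a) × ZMod (2 * b)) :
    ∃ u v, g = evenPoint _ _ u v ∨ ∃ r, g = involution a b r + evenPoint _ _ u v := by
  obtain ⟨x, y⟩ := g
  obtain ⟨x, rfl⟩ := ZMod.intCast_surjective x
  obtain ⟨y, rfl⟩ := ZMod.intCast_surjective y
  have split : ∀ {c : ℕ}, Odd c → ∀ z : ℤ, ∃ u, z = 2 * u ∨ z = c + 2 * u := by
    rintro c ⟨d, rfl⟩ z
    exact ⟨if z % 2 = 0 then z / 2 else z / 2 - d, by grind⟩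
  obtain ⟨u, hu⟩ := split ha x
  obtain ⟨v, hv⟩ := split hb y
  refine ⟨u, v, ?_⟩
  obtain rfl | rfl := hu <;> obtain rfl | rfl := hv
  · exact .inl rfl
  · exact .inr ⟨1, by ext <;> simp [involution, evenPoint]⟩
  · exact .inr ⟨0, by ext <;> simp [involution, evenPoint]⟩
  · exact .inr ⟨2, by ext <;> simp [involution, evenPoint]⟩

lemma exists_dvd_sub_mul (q : ℕ) (r : Fin 3) (v : ℤ) :
    ∃ w : Fin (2 * q + 1), ((2 * q + 1 : ℕ) : ℤ) ∣ v - ![1, 1, -2] r * (w : ℕ) := by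
  have residue : ∀ z : ℤ, ∃ w : Fin (2 * q + 1), ((2 * q + 1 : ℕ) : ℤ) ∣ z - (w : ℕ) := by
    intro z
    have h0 := Int.emod_nonneg z (by positivity : ((2 * q + 1 : ℕ) : ℤ) ≠ 0)
    have h1 := Int.emod_lt_of_pos z (by positivity : (0 : ℤ) < (2 * q + 1 : ℕ))
    refine ⟨⟨(z % (2 * q + 1 : ℕ)).toNat, by omega⟩, ?_⟩
    rw [Int.toNat_of_nonneg h0]
    exact Int.dvd_self_sub_emod
  fin_cases r
  · simpa using residue v
  · simpa using residue v
  · obtain ⟨w, c, hc⟩ := residue (q * v)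
    refine ⟨w, v - 2 * c, ?_⟩
    push_cast at hc ⊢
    simp
    linear_combination -2 * hc

/-- The set of elements of `Z_m × Z_n` outside `{0, m/2} × Z_n` is large. -/
lemma card_filter_two_zsmul_ne_zero (a n : ℕ) [NeZero a] [NeZero n] :
    (2 * a - 2) * n ≤ #{g : ZMod (2 * a) × ZMod n | (2 : ℤ) • g.1 ≠ 0} := by
  have hsub : ({g : ZMod (2 * a) × ZMod n | ¬ (2 : ℤ) • g.1 ≠ 0} : Finset _) ⊆
      ({0, (a : ZMod (2 * a))} : Finset _) ×ˢ univ := by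
    rintro ⟨x, y⟩ h
    obtain ⟨x, rfl⟩ := ZMod.intCast_surjective x
    simp only [mem_filter, mem_univ, true_and, not_not, zsmul_eq_mul] at h
    rw [← Int.cast_mul, ZMod.intCast_zmod_eq_zero_iff_dvd, Nat.cast_mul] at h
    obtain ⟨c, rfl⟩ := Int.dvd_of_mul_dvd_mul_left two_ne_zero h
    have h2 := two_mul_self_eq_zero a
    simp only [mem_product, mem_insert, mem_singleton, mem_univ, and_true]
    obtain ⟨d, rfl⟩ | ⟨d, rfl⟩ := c.even_or_odd
    · left
      push_cast
      linear_combination (d : ZMod (2 * a)) * h2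
    · right
      push_cast
      linear_combination (d : ZMod (2 * a)) * h2
  have hle : #({g : ZMod (2 * a) × ZMod n | ¬ (2 : ℤ) • g.1 ≠ 0} : Finset _) ≤ 2 * n := by
    refine (card_le_card hsub).trans ?_
    rw [card_product, card_univ, ZMod.card]
    exact Nat.mul_le_mul_right _ card_le_two
  have htot := card_filter_add_card_filter_not (s := (univ : Finset (ZMod (2 * a) × ZMod n)))
    (fun g => (2 : ℤ) • g.1 ≠ 0)
  rw [card_univ, Fintype.card_prod, ZMod.card, ZMod.card] at htot
  rw [Nat.sub_mul]
  omega

theorem stmt17 (m n : ℕ) (hm : 0 < m) (hn : 0 < n)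
    (hm12 : m % 12 = 2) (hn4 : n % 4 = 2) :
    ∃ F : Finset (Finset (ZMod m × ZMod n)),
      OOSPC m n 3 2 1 F ∧ Regular m n 2 n F ∧ F.card = 5 * n * (m - 2) / 24 := by
  obtain ⟨s, rfl⟩ : ∃ s, m = 2 * (6 * s + 1) := ⟨m / 12, by omega⟩
  obtain ⟨q, rfl⟩ : ∃ q, n = 2 * (2 * q + 1) := ⟨n / 4, by omega⟩
  have : NeZero (2 * (6 * s + 1)) := ⟨hm.ne'⟩
  have : NeZero (2 * (2 * q + 1)) := ⟨hn.ne'⟩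
  obtain ⟨k, hk, hcov⟩ := exists_zeroSum_triples s
  let e := involution (6 * s + 1) (2 * q + 1)
  let K : Fin s × Fin (2 * q + 1) → Fin 3 → ZMod (2 * (6 * s + 1)) × ZMod (2 * (2 * q + 1)) :=
    fun j r => evenPoint _ _ (k j.1 r) (![1, 1, -2] r * (j.2 : ℕ))
  have he : ∀ r, (2 : ℤ) • e r = 0 := two_zsmul_involution _ _
  have he' : ∑ r, e r = 0 := sum_involution _ _
  have hK : ∀ j, ∑ r, K j r = 0 := by
    intro j
    have h := hk j.1
    rw [Fin.sum_univ_three] at h ⊢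
    refine Prod.ext ?_ ?_
    · change ((2 * k j.1 0 : ℤ) : ZMod (2 * (6 * s + 1))) + ((2 * k j.1 1 : ℤ) : ZMod _) +
        ((2 * k j.1 2 : ℤ) : ZMod _) = 0
      rw [← Int.cast_add, ← Int.cast_add, ← mul_add, ← mul_add, h, mul_zero, Int.cast_zero]
    · simp [K, evenPoint]
      ring
  have hKcov : ∀ u v : ℤ, ¬ (6 * s + 1 : ℤ) ∣ u →
      ∃ j r, evenPoint _ _ u v = K j r ∨ evenPoint _ _ u v = -K j r := by
    intro u v hu
    obtain ⟨i, r, h | h⟩ := hcov u hu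
    · obtain ⟨w, hw⟩ := exists_dvd_sub_mul q r v
      exact ⟨(i, w), r, .inl (evenPoint_eq (by exact_mod_cast h) hw)⟩
    · obtain ⟨w, hw⟩ := exists_dvd_sub_mul q r (-v)
      refine ⟨(i, w), r, .inr ?_⟩
      rw [neg_evenPoint]
      refine evenPoint_eq (by push_cast; rwa [sub_neg_eq_add]) ?_
      rw [← dvd_neg]
      exact hw.trans (dvd_of_eq (by ring))
  set S : Finset (ZMod (2 * (6 * s + 1)) × ZMod (2 * (2 * q + 1))) :=
    {g | (2 : ℤ) • g.1 ≠ 0} with hS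
  have hcard : 24 * Fintype.card (Fin s × Fin (2 * q + 1)) ≤ #S := by
    refine le_trans (le_of_eq ?_) (card_filter_two_zsmul_ne_zero (6 * s + 1) (2 * (2 * q + 1)))
    rw [Fintype.card_prod, Fintype.card_fin, Fintype.card_fin,
      show 2 * (6 * s + 1) - 2 = 12 * s by omega]
    ring
  obtain ⟨hinj, himage⟩ := slotDiff_injective_and_image_eq (e := e) (K := K) S hcard (by
    intro g hg
    have hdvd : ∀ u : ℤ, (6 * s + 1 : ℤ) ∣ u →
        (2 : ℤ) • ((2 * u : ℤ) : ZMod (2 * (6 * s + 1))) = 0 := by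
      rintro _ ⟨c, rfl⟩
      have h2 := two_mul_self_eq_zero (6 * s + 1)
      push_cast at h2 ⊢
      rw [zsmul_eq_mul]
      push_cast
      linear_combination (2 * c : ZMod (2 * (6 * s + 1))) * h2
    simp only [hS, mem_filter, mem_univ, true_and] at hg
    obtain ⟨u, v, rfl | ⟨r', rfl⟩⟩ := exists_eq_evenPoint ⟨3 * s, by ring⟩ ⟨q, rfl⟩ g
    · have hu : ¬ (6 * s + 1 : ℤ) ∣ u := fun h => hg (hdvd u h)
      obtain ⟨j, r, h⟩ := hKcov (u * (3 * s + 1)) (v * (q + 1)) fun h => hu <|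
        (dvd_sub (h.mul_left 2) (dvd_mul_left (6 * s + 1 : ℤ) u)).trans (dvd_of_eq (by ring))
      have hhalf : evenPoint (2 * (6 * s + 1)) (2 * (2 * q + 1)) u v =
          (2 : ℤ) • evenPoint _ _ (u * (3 * s + 1)) (v * (q + 1)) := by
        rw [two_zsmul_evenPoint]
        exact evenPoint_eq ⟨-u, by push_cast; ring⟩ ⟨-v, by push_cast; ring⟩
      refine ⟨j, r, .inl (h.imp (fun h => ?_) fun h => ?_)⟩
      · rw [hhalf, h]
      · rw [hhalf, h, zsmul_neg]
    · have hu : ¬ (6 * s + 1 : ℤ) ∣ u := by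
        intro h
        apply hg
        rw [Prod.fst_add, zsmul_add]
        exact (congrArg₂ (· + ·) (congrArg Prod.fst (he r')) (hdvd u h)).trans (add_zero 0)
      obtain ⟨j, r, h⟩ := hKcov u v hu
      refine ⟨j, r, .inr ⟨r', h.imp (fun h => ?_) fun h => ?_⟩⟩
      · rw [h]
      · rw [h, neg_add, ← eq_neg_of_add_eq_zero_left ((two_zsmul _).symm.trans (he r'))])
  have hslot : ∀ σ, (2 : ℤ) • (slotDiff e K σ).1 ≠ 0 := by
    intro σ
    have : slotDiff e K σ ∈ S := himage ▸ mem_image_of_mem _ (mem_univ σ)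
    simpa [hS] using this
  have hne := nonzeroPoints_ne he he' hK hinj fun σ h => hslot σ (congrArg Prod.fst h)
  have hcodeword : Function.Injective (codeword e K) := by
    intro c d hcd
    have h0 : (0 : ZMod (2 * (6 * s + 1)) × ZMod (2 * (2 * q + 1))) ∈ codeword e K c := by
      simp [codeword]
    have h1 : (nonzeroPoints e K c).1 ∈ codeword e K c := by simp [codeword]
    exact eq_of_sub_eq_sub he he' hK hinj h1 h0 (hcd ▸ h1) (hcd ▸ h0) (hne c).1 rfl
  refine ⟨univ.image (codeword e K), ⟨?_, ?_, ?_⟩, ?_, ?_⟩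
  · simp only [mem_image, mem_univ, true_and, forall_exists_index, forall_apply_eq_imp_iff]
    intro c
    obtain ⟨hp, hq, hpq, -⟩ := hne c
    exact card_eq_three.2 ⟨_, _, _, hp.symm, hq.symm, hpq, rfl⟩
  · simp only [mem_image, mem_univ, true_and, forall_exists_index, forall_apply_eq_imp_iff]
    intro c g hg
    obtain ⟨-, hq, -, hpq, hp2, hq2⟩ := hne c
    exact card_inter_translate_le_two hq hpq hp2 hq2 hg
  · simp only [mem_image, mem_univ, true_and, forall_exists_index, forall_apply_eq_imp_iff]
    intro c d hcd g
    refine card_inter_translate_le_one (fun x hx x' hx' y hy y' hy' hxx h => hcd ?_) g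
    rw [eq_of_sub_eq_sub he he' hK hinj hx hx' hy hy' hxx h]
  · ext g
    have hdiff : (∃ c, ∃ x ∈ codeword e K c, ∃ y ∈ codeword e K c, x ≠ y ∧ x - y = g) ↔
        (2 : ℤ) • g.1 ≠ 0 := by
      constructor
      · rintro ⟨c, x, hx, y, hy, hxy, rfl⟩
        obtain ⟨σ, -, h⟩ := exists_slot_of_ne he he' hK hx hy hxy
        exact h ▸ hslot σ
      · intro hg
        have hgS : g ∈ univ.image (slotDiff e K) := by rw [himage]; simpa [hS] using hg
        obtain ⟨σ, -, rfl⟩ := mem_image.1 hgS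
        obtain ⟨x, hx, y, hy, h⟩ := exists_sub_eq_slotDiff he' hK σ
        refine ⟨_, x, hx, y, hy, ?_, h⟩
        rintro rfl
        rw [← h, sub_self] at hg
        simp at hg
    have hn0 : (2 * (2 * q + 1)) • g.2 = 0 := by simp
    have h2 : (2 : ℕ) • g.1 = (2 : ℤ) • g.1 := by simp
    simp only [Set.mem_insert_iff, leave, Set.mem_ofPred_eq, hn0, and_true, h2, mem_image,
      mem_univ, true_and, forall_exists_index, forall_apply_eq_imp_iff]
    rw [← not_iff_not, ← ne_eq ((2 : ℤ) • g.1), ← hdiff]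
    by_cases hg : g = 0
    · simp only [hg, true_or, not_true_eq_false, sub_eq_zero, false_iff]
      rintro ⟨_, _, _, _, _, hxy, h⟩
      exact hxy h
    · simp only [hg, false_or, ne_eq, not_false_eq_true, true_and]
      push Not
      refine exists_congr fun c => exists_congr fun x => and_congr_right fun _ =>
        exists_congr fun y => and_congr_right fun _ => ⟨fun h => ⟨?_, h⟩, And.right⟩
      rintro rfl
      exact hg (by rw [← h, sub_self])
  · rw [card_image_of_injective _ hcodeword, card_univ,
      show 2 * (6 * s + 1) - 2 = 12 * s by omega]
    simp only [Fintype.card_sum, Fintype.card_prod, Fintype.card_fin]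
    symm
    apply Nat.div_eq_of_eq_mul_left (by norm_num)
    ring
end

section
/- For all positive integers m and n with m ≡ 2 or 10 (mod 12) and n ≡ 6 (mod 12), there exists a (1,3)-regular (m,n,3,2,1)-OOSPC with (5mn−12)/24 codewords. -/
open Finset

/-- The differences occurring in the triple `{0, u, -w}`. -/
def tripleDiff {G : Type*} [AddCommGroup G] [DecidableEq G] (p : G × G) : Finset G :=
  {p.1, -p.1, p.2, -p.2, p.1 + p.2, -(p.1 + p.2)}

/-- The triple `{0, u, -w}`. -/
def triple {G : Type*} [AddCommGroup G] [DecidableEq G] (p : G × G) : Finset G :=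
  {0, p.1, -p.2}

section Counting

variable {G ι : Type*} [AddCommGroup G] [DecidableEq G]

lemma neg_mem_tripleDiff {p : G × G} {g : G} (h : g ∈ tripleDiff p) : -g ∈ tripleDiff p := by
  simp only [tripleDiff, mem_insert, mem_singleton] at h ⊢
  rcases h with h | h | h | h | h | h <;> simp [h]

lemma sub_mem_tripleDiff {p : G × G} {x y : G} (hx : x ∈ triple p) (hy : y ∈ triple p)
    (hxy : x ≠ y) : x - y ∈ tripleDiff p := by
  simp only [triple, tripleDiff, mem_insert, mem_singleton] at hx hy ⊢
  rcases hx with rfl | rfl | rfl <;> rcases hy with rfl | rfl | rfl <;>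
    first
    | exact absurd rfl hxy
    | simp [sub_eq_add_neg, add_comm]

lemma exists_sub_of_mem_tripleDiff {p : G × G} {g : G} (h : g ∈ tripleDiff p) :
    ∃ x ∈ triple p, ∃ y ∈ triple p, x - y = g := by
  simp only [triple, tripleDiff, mem_insert, mem_singleton] at h ⊢
  rcases h with rfl | rfl | rfl | rfl | rfl | rfl
  · exact ⟨p.1, by simp, 0, by simp, by simp⟩
  · exact ⟨0, by simp, p.1, by simp, by simp⟩
  · exact ⟨0, by simp, -p.2, by simp, by simp⟩
  · exact ⟨-p.2, by simp, 0, by simp, by simp⟩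
  · exact ⟨p.1, by simp, -p.2, by simp, by simp⟩
  · exact ⟨-p.2, by simp, p.1, by simp, by abel⟩

lemma card_tripleDiff_le_six (p : G × G) : (tripleDiff p).card ≤ 6 := card_le_six

lemma card_tripleDiff_self_le_four (u : G) : (tripleDiff (u, u)).card ≤ 4 := by
  have : tripleDiff (u, u) ⊆ {u, -u, u + u, -(u + u)} := by
    intro g
    simp only [tripleDiff, mem_insert, mem_singleton]
    tauto
  exact (card_le_card this).trans card_le_four

lemma card_tripleDiff_le_three {u w : G} (hu : -u = u) (hw : -w = w) :
    (tripleDiff (u, w)).card ≤ 3 := by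
  have : tripleDiff (u, w) ⊆ {u, w, u + w} := by
    intro g
    simp only [tripleDiff, mem_insert, mem_singleton, neg_add, hu, hw]
    tauto
  exact (card_le_card this).trans card_le_three

lemma card_triple {p : G × G} (h0 : (0 : G) ∉ tripleDiff p) : (triple p).card = 3 := by
  simp only [tripleDiff, mem_insert, mem_singleton, not_or] at h0
  obtain ⟨h1, -, -, h3, h4, -⟩ := h0
  refine card_eq_three.2 ⟨0, p.1, -p.2, h1, h3, fun h => h4 ?_, rfl⟩
  rw [h]; simp

lemma eq_of_translation_derangement {G : Type*} [AddCommGroup G] {u w g : G} (hg : g ≠ 0)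
    (hu : ¬ 0 = u) (hw : ¬ 0 = -w) (huw : ¬ 0 = u + w)
    (k0 : 0 = g ∨ 0 = g + u ∨ 0 = g + -w) (k1 : u = g ∨ u = g + u ∨ u = g + -w)
    (k2 : -w = g ∨ -w = g + u ∨ -w = g + -w) : w = u ∧ u + w = -u := by
  have e1 : ¬ u = g + u := by simpa using hg
  have e2 : ¬ -w = g + -w := by simpa using hg
  have e3 : ¬ u = -w := fun h => huw (by simp [h])
  have e4 : g + u = 0 → g = -u := eq_neg_of_add_eq_zero_left
  have e5 : -w = -u → w = u := neg_inj.1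
  have e6 : g + -w = 0 → g = w := fun h => by simpa using eq_neg_of_add_eq_zero_left h
  rcases k0 with k0 | k0 | k0
  · exact absurd k0.symm hg
  all_goals
    rcases k1 with k1 | k1 | k1 <;> rcases k2 with k2 | k2 | k2 <;> grind

/-- A triple with at least three differences is not a coset of a subgroup of order three. -/
lemma card_inter_translate_triple_le_two {p : G × G} (h0 : (0 : G) ∉ tripleDiff p)
    (h3 : 3 ≤ (tripleDiff p).card) {g : G} (hg : g ≠ 0) :
    (triple p ∩ (triple p).image (fun x => g + x)).card ≤ 2 := by
  by_contra hlt
  have hsub : triple p ⊆ (triple p).image (fun x => g + x) := by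
    have : triple p ∩ (triple p).image (fun x => g + x) = triple p := by
      apply eq_of_subset_of_card_le inter_subset_left
      rw [card_triple h0]; omega
    exact inter_eq_left.1 this
  have key : ∀ x ∈ triple p, ∃ y ∈ triple p, x = g + y := fun x hx => by
    obtain ⟨y, hy, h⟩ := mem_image.1 (hsub hx)
    exact ⟨y, hy, h.symm⟩
  have hsmall : ∀ S : Finset G, S.card ≤ 2 → ¬ tripleDiff p ⊆ S := fun S hS h => by
    have := card_le_card h
    omega
  obtain ⟨u, w⟩ := p
  have k0 := key 0 (by simp [triple])
  have k1 := key u (by simp [triple])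
  have k2 := key (-w) (by simp [triple])
  simp only [tripleDiff, mem_insert, mem_singleton, not_or] at h0
  obtain ⟨h1, -, -, h3, h4, -⟩ := h0
  simp only [triple, mem_insert, mem_singleton, exists_eq_or_imp, exists_eq_left, add_zero] at k0 k1 k2
  have hu := eq_of_translation_derangement hg h1 h3 h4 k0 k1 k2
  refine hsmall {u, -u} card_le_two fun x hx => ?_
  simp only [tripleDiff, mem_insert, mem_singleton, hu.2, neg_neg] at hx ⊢
  rw [hu.1] at hx
  rcases hx with h | h | h | h | h | h <;> simp [h]

theorem tripleDiff_partition [Fintype G] {I : Finset ι} {f : ι → G × G} {w : ι → ℕ} {T : Finset G}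
    (hw : ∀ i ∈ I, (tripleDiff (f i)).card ≤ w i) (hsum : ∑ i ∈ I, w i ≤ Tᶜ.card)
    (hcov : ∀ g, g ∉ T → ∃ i ∈ I, g ∈ tripleDiff (f i)) :
    (∀ i ∈ I, (tripleDiff (f i)).card = w i) ∧
    (∀ i ∈ I, ∀ j ∈ I, i ≠ j → Disjoint (tripleDiff (f i)) (tripleDiff (f j))) ∧
    (∀ i ∈ I, ∀ g ∈ tripleDiff (f i), g ∉ T) := by
  classical
  have hsub : Tᶜ ⊆ I.biUnion fun i => tripleDiff (f i) := fun g hg => by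
    simpa using hcov g (by simpa using hg)
  have h1 := card_le_card hsub
  have h2 : (I.biUnion fun i => tripleDiff (f i)).card ≤ ∑ i ∈ I, (tripleDiff (f i)).card :=
    card_biUnion_le
  have h3 := sum_le_sum hw
  refine ⟨?_, ?_, ?_⟩
  · exact (sum_eq_sum_iff_of_le hw).1 (by omega)
  · intro i hi j hj hij
    rw [disjoint_left]
    intro g hgi hgj
    have hU : (I.biUnion fun i => tripleDiff (f i)) ⊆
        (I.erase i).biUnion (fun i => tripleDiff (f i)) ∪ (tripleDiff (f i)).erase g := by
      intro x hx
      obtain ⟨k, hk, hxk⟩ := mem_biUnion.1 hx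
      by_cases hki : k = i
      · subst hki
        by_cases hxg : x = g
        · subst hxg
          exact mem_union_left _ (mem_biUnion.2 ⟨j, mem_erase.2 ⟨hij.symm, hj⟩, hgj⟩)
        · exact mem_union_right _ (mem_erase.2 ⟨hxg, hxk⟩)
      · exact mem_union_left _ (mem_biUnion.2 ⟨k, mem_erase.2 ⟨hki, hk⟩, hxk⟩)
    have h4 := (card_le_card hU).trans (card_union_le _ _)
    have h5 : ((I.erase i).biUnion fun i => tripleDiff (f i)).card ≤
        ∑ i ∈ I.erase i, (tripleDiff (f i)).card := card_biUnion_le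
    have h6 := add_sum_erase I (fun i => (tripleDiff (f i)).card) hi
    have h7 := card_erase_lt_of_mem hgi
    omega
  · intro i hi g hg
    have : Tᶜ = I.biUnion fun i => tripleDiff (f i) := eq_of_subset_of_card_le hsub (by omega)
    rw [← mem_compl, this]
    exact mem_biUnion.2 ⟨i, hi, hg⟩

end Counting

/-- A family of triples whose differences cover the complement of the subgroup `1 × C₃` with no
room to spare is a `(1, 3)`-regular optical orthogonal signature pattern code. -/
theorem exists_OOSPC_of_cover {ι : Type*} {m n : ℕ} [NeZero m] [NeZero n] {I : Finset ι}
    {f : ι → (ZMod m × ZMod n) × (ZMod m × ZMod n)} {w : ι → ℕ} {T : Finset (ZMod m × ZMod n)}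
    (hT : ∀ p, p ∈ T ↔ 1 • p.1 = 0 ∧ 3 • p.2 = 0)
    (hw3 : ∀ i ∈ I, 3 ≤ w i)
    (hw : ∀ i ∈ I, (tripleDiff (f i)).card ≤ w i) (hsum : ∑ i ∈ I, w i ≤ Tᶜ.card)
    (hcov : ∀ g, g ∉ T → ∃ i ∈ I, g ∈ tripleDiff (f i)) :
    ∃ F : Finset (Finset (ZMod m × ZMod n)),
      OOSPC m n 3 2 1 F ∧ Regular m n 1 3 F ∧ F.card = I.card := by
  obtain ⟨hcard, hdisj, hnT⟩ := tripleDiff_partition hw hsum hcov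
  have hT0 : (0 : ZMod m × ZMod n) ∈ T := by simp [hT]
  have h0 : ∀ i ∈ I, (0 : ZMod m × ZMod n) ∉ tripleDiff (f i) := fun i hi h => hnT i hi 0 h hT0
  have hcross : ∀ i ∈ I, ∀ j ∈ I, i ≠ j → ∀ g,
      (triple (f i) ∩ (triple (f j)).image (fun x => g + x)).card ≤ 1 := by
    intro i hi j hj hij g
    rw [card_le_one]
    intro x hx y hy
    by_contra hxy
    obtain ⟨hx1, hx2⟩ := mem_inter.1 hx
    obtain ⟨hy1, hy2⟩ := mem_inter.1 hy
    obtain ⟨x', hx', rfl⟩ := mem_image.1 hx2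
    obtain ⟨y', hy', rfl⟩ := mem_image.1 hy2
    have hd := sub_mem_tripleDiff hx1 hy1 hxy
    rw [add_sub_add_left_eq_sub] at hd
    exact disjoint_left.1 (hdisj i hi j hj hij) hd
      (sub_mem_tripleDiff hx' hy' fun h => hxy (by rw [h]))
  refine ⟨I.image fun i => triple (f i), ⟨?_, ?_, ?_⟩, ?_, ?_⟩
  · intro X hX
    obtain ⟨i, hi, rfl⟩ := mem_image.1 hX
    exact card_triple (h0 i hi)
  · intro X hX g hg
    obtain ⟨i, hi, rfl⟩ := mem_image.1 hX
    exact card_inter_translate_triple_le_two (h0 i hi) ((hw3 i hi).trans (hcard i hi).ge) hg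
  · intro X hX Y hY hXY g
    obtain ⟨i, hi, rfl⟩ := mem_image.1 hX
    obtain ⟨j, hj, rfl⟩ := mem_image.1 hY
    exact hcross i hi j hj (fun h => hXY (by rw [h])) g
  · ext g
    simp only [Set.mem_insert_iff, leave, Set.mem_ofPred_eq, ← hT]
    constructor
    · rintro (rfl | ⟨-, hg⟩)
      · exact hT0
      · by_contra hgT
        obtain ⟨i, hi, hgi⟩ := hcov g hgT
        obtain ⟨x, hx, y, hy, h⟩ := exists_sub_of_mem_tripleDiff hgi
        exact hg _ (mem_image_of_mem _ hi) x hx y hy h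
    · intro hg
      refine or_iff_not_imp_left.2 fun hg0 => ⟨hg0, ?_⟩
      intro X hX x hx y hy h
      obtain ⟨i, hi, rfl⟩ := mem_image.1 hX
      have hxy : x ≠ y := fun e => hg0 (by rw [← h, e, sub_self])
      exact hnT i hi g (h ▸ sub_mem_tripleDiff hx hy hxy) hg
  · apply card_image_of_injOn
    intro i hi j hj hij
    by_contra hne
    have h1 := hcross i hi j hj hne 0
    have h2 : triple (f i) = triple (f j) := hij
    rw [← h2] at h1
    simp only [zero_add, image_id', inter_self, card_triple (h0 i hi)] at h1
    omega

section Coordinates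

/-- The point of `C_{2(2 * s+1)} × C_{2(6 * r+3)}` with `2`-part `(a, b)` and odd part `(c, i)`. -/
def point (s r : ℕ) (a b c i : ℤ) : ZMod (2 * (2 * s + 1)) × ZMod (2 * (6 * r + 3)) :=
  (((2 * s + 1) * a + 2 * c : ℤ), ((6 * r + 3) * b + 2 * i : ℤ))

variable {s r : ℕ}

lemma point_add (a b c i a' b' c' i' : ℤ) : point s r a b c i + point s r a' b' c' i' =
    point s r (a + a') (b + b') (c + c') (i + i') := by
  simp only [point, Prod.mk_add_mk, ← Int.cast_add]
  congr 2 <;> ring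

lemma neg_point (a b c i : ℤ) : -point s r a b c i = point s r (-a) (-b) (-c) (-i) := by
  simp only [point, Prod.neg_mk, ← Int.cast_neg]
  congr 2 <;> ring

lemma point_shift (a b c i k l u v : ℤ) :
    point s r (a + 2 * k) (b + 2 * l) (c + (2 * s + 1) * u) (i + (6 * r + 3) * v) =
      point s r a b c i := by
  simp only [point, Prod.mk.injEq, ZMod.intCast_eq_intCast_iff_dvd_sub]
  push_cast
  exact ⟨⟨-(k + u), by ring⟩, ⟨-(l + v), by ring⟩⟩

lemma point_eq {a b c i a' b' c' i' : ℤ} (k l u v : ℤ) (ha : a' = a + 2 * k) (hb : b' = b + 2 * l)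
    (hc : c' = c + (2 * s + 1) * u) (hi : i' = i + (6 * r + 3) * v) :
    point s r a' b' c' i' = point s r a b c i := by
  rw [ha, hb, hc, hi, point_shift]

lemma neg_point' (a b c i : ℤ) : -point s r a b c i = point s r a b (-c) (-i) := by
  rw [neg_point]
  exact point_eq (-a) (-b) 0 0 (by ring) (by ring) (by ring) (by ring)

lemma exists_point_eq (g : ZMod (2 * (2 * s + 1)) × ZMod (2 * (6 * r + 3))) :
    ∃ a b c i : ℤ, (a = 0 ∨ a = 1) ∧ (b = 0 ∨ b = 1) ∧ g = point s r a b c i := by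
  obtain ⟨p, q⟩ := g
  obtain ⟨p, rfl⟩ := ZMod.intCast_surjective p
  obtain ⟨q, rfl⟩ := ZMod.intCast_surjective q
  have h : ((p : ZMod (2 * (2 * s + 1))), (q : ZMod (2 * (6 * r + 3)))) =
      point s r p q (-s * p) (-(3 * r + 1) * q) := by
    simp only [point]
    congr 2 <;> ring
  refine ⟨p % 2, q % 2, -s * p, -(3 * r + 1) * q, by omega, by omega, ?_⟩
  rw [h]
  exact point_eq (p / 2) (q / 2) 0 0 (by omega) (by omega) (by ring) (by ring)

/-- Every integer is congruent modulo `2 * s+1`, up to sign, to one of `0, …, s`. -/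
lemma exists_half_residue (s : ℕ) (c : ℤ) :
    ∃ d u : ℤ, 0 ≤ d ∧ d ≤ s ∧ (d = c + (2 * s + 1) * u ∨ d = -c + (2 * s + 1) * u) := by
  have h0 := Int.emod_nonneg c (show (2 * s + 1 : ℤ) ≠ 0 by omega)
  have h1 := Int.emod_lt_of_pos c (show (0 : ℤ) < 2 * s + 1 by omega)
  have h2 := Int.emod_add_mul_ediv c (2 * s + 1)
  by_cases h : c % (2 * s + 1) ≤ s
  · exact ⟨c % (2 * s + 1), -(c / (2 * s + 1)), h0, h, Or.inl (by linarith)⟩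
  · refine ⟨2 * s + 1 - c % (2 * s + 1), 1 + c / (2 * s + 1), by omega, by omega, Or.inr ?_⟩
    linarith

end Coordinates

section Blocks

/-- The first two components of the `t`-th zero-sum triple of the difference system modulo `6 * r+3`. -/
def zeroSum (r : ℕ) (t : ℤ) : ℤ × ℤ :=
  if t = 2 * r then (3 * r + 1, 2 * r + 1)
  else if t < r then (r + 2 + 2 * t, -(2 * r + 2) - t)
  else if t = 2 * r - 1 then (r + 1, r)
  else (3 - r + 2 * t, r - 1 - t)

/-- The `2`-part attached to the residue class of `i` modulo `3`. -/
def classMod (i : ℤ) : ℤ × ℤ :=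
  if i % 3 = 0 then (1, 0) else if i % 3 = 1 then (0, 1) else (1, 1)

/-- The `2`-part attached to the interval of `[1, 3 * r+1]` containing `d`. -/
def classInterval (r : ℕ) (d : ℤ) : ℤ × ℤ :=
  if d ≤ r then (1, 0) else if d ≤ 2 * r then (0, 1) else (1, 1)

/-- Labels for the triples of the code. -/
abbrev Label : Type := Unit ⊕ (ℤ × ℤ) ⊕ ℤ ⊕ (ℤ × ℤ) ⊕ (ℤ × ℤ) ⊕ ℤ

/-- The labels in use. -/
noncomputable def labels (s r : ℕ) : Finset Label :=
  (univ : Finset Unit).disjSum <|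
    (Icc (1 : ℤ) s ×ˢ Ico (0 : ℤ) (6 * r + 3)).disjSum <|
    ((Icc (1 : ℤ) (3 * r + 1)).erase (2 * r + 1)).disjSum <|
    (Icc (1 : ℤ) s ×ˢ Ico (0 : ℤ) (2 * r + 1)).disjSum <|
    (Icc (1 : ℤ) s ×ˢ Ico (0 : ℤ) (2 * r + 1)).disjSum <|
    Ico (0 : ℤ) (2 * r + 1)

/-- The number of differences of the triple with a given label. -/
def weight : Label → ℕ :=
  Sum.elim (fun _ => 3) <| Sum.elim (fun _ => 4) <| Sum.elim (fun _ => 4) fun _ => 6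

/-- The generators of the triple with a given label. -/
def generators (s r : ℕ) : Label →
    (ZMod (2 * (2 * s + 1)) × ZMod (2 * (6 * r + 3))) ×
      (ZMod (2 * (2 * s + 1)) × ZMod (2 * (6 * r + 3))) :=
  Sum.elim (fun _ => (point s r 1 0 0 0, point s r 0 1 0 0)) <|
  Sum.elim (fun p => (point s r (classMod p.2).1 (classMod p.2).2 p.1 p.2,
    point s r (classMod p.2).1 (classMod p.2).2 p.1 p.2)) <|
  Sum.elim (fun d => (point s r (classInterval r d).1 (classInterval r d).2 0 d,
    point s r (classInterval r d).1 (classInterval r d).2 0 d)) <|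
  Sum.elim (fun p => (point s r 0 1 p.1 (3 * p.2), point s r 1 1 p.1 (1 + 3 * p.2))) <|
  Sum.elim (fun p => (point s r 0 1 p.1 (-1 - 3 * p.2), point s r 1 1 p.1 (-3 * p.2)))
  fun t => (point s r 1 0 0 (zeroSum r t).1, point s r 0 1 0 (zeroSum r t).2)

variable (s r : ℕ)

lemma card_labels : (labels s r).card = 5 * s * (2 * r + 1) + 5 * r + 2 := by
  have h : (2 * r + 1 : ℤ) ∈ Icc (1 : ℤ) (3 * r + 1) := by simp; omega
  simp only [labels, card_disjSum, card_product, card_erase_of_mem h, Int.card_Icc, Int.card_Ico,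
    card_univ, Fintype.card_unit]
  rw [show (s + 1 - 1 : ℤ).toNat = s by omega, show (6 * r + 3 - 0 : ℤ).toNat = 6 * r + 3 by omega,
    show (3 * r + 1 + 1 - 1 : ℤ).toNat = 3 * r + 1 by omega,
    show (2 * r + 1 - 0 : ℤ).toNat = 2 * r + 1 by omega, Nat.add_sub_cancel]
  ring

lemma sum_weight : ∑ x ∈ labels s r, weight x = 12 * (2 * s + 1) * (2 * r + 1) - 3 := by
  have h : (2 * r + 1 : ℤ) ∈ Icc (1 : ℤ) (3 * r + 1) := by simp; omega
  simp only [labels, weight, sum_disjSum, card_disjSum, Sum.elim_inl, Sum.elim_inr, sum_const, card_product,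
    card_erase_of_mem h, Int.card_Icc, Int.card_Ico, card_univ, Fintype.card_unit, smul_eq_mul]
  rw [show (s + 1 - 1 : ℤ).toNat = s by omega, show (6 * r + 3 - 0 : ℤ).toNat = 6 * r + 3 by omega,
    show (3 * r + 1 + 1 - 1 : ℤ).toNat = 3 * r + 1 by omega,
    show (2 * r + 1 - 0 : ℤ).toNat = 2 * r + 1 by omega, Nat.add_sub_cancel]
  apply Nat.eq_sub_of_add_eq
  ring

lemma three_le_weight (x : Label) : 3 ≤ weight x := by
  rcases x with x | x | x | x | x | x <;> simp [weight]

lemma card_tripleDiff_generators_le (x : Label) : (tripleDiff (generators s r x)).card ≤ weight x := by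
  rcases x with x | x | x | x | x | x
  · apply card_tripleDiff_le_three
    · rw [neg_point', neg_zero]
    · rw [neg_point', neg_zero]
  · exact card_tripleDiff_self_le_four _
  · exact card_tripleDiff_self_le_four _
  all_goals exact card_tripleDiff_le_six _

/-- The elements killed by `(1, 3)`. -/
def coreSubgroup : Finset (ZMod (2 * (2 * s + 1)) × ZMod (2 * (6 * r + 3))) :=
  {p | 1 • p.1 = 0 ∧ 3 • p.2 = 0}

lemma card_coreSubgroup_le : (coreSubgroup s r).card ≤ 3 := by
  have : coreSubgroup s r ⊆ {0, point s r 0 0 0 (2 * r + 1), point s r 0 0 0 (2 * (2 * r + 1))} := by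
    rintro ⟨p, q⟩ h
    obtain ⟨q, rfl⟩ := ZMod.intCast_surjective q
    simp only [coreSubgroup, mem_filter, mem_univ, true_and, one_smul, nsmul_eq_mul] at h
    obtain ⟨rfl, h⟩ := h
    have h' : (((3 * q : ℤ)) : ZMod (2 * (6 * r + 3))) = 0 := by push_cast; exact h
    rw [ZMod.intCast_zmod_eq_zero_iff_dvd] at h'
    obtain ⟨k, hk⟩ := h'
    push_cast at hk
    have hq : q = 2 * (2 * r + 1) * k := by linarith
    have hk3 : k % 3 = 0 ∨ k % 3 = 1 ∨ k % 3 = 2 := by omega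
    have hdiv := Int.emod_add_mul_ediv k 3
    simp only [mem_insert, mem_singleton, point, Prod.mk.injEq, Prod.zero_eq_mk,
      ZMod.intCast_zmod_eq_zero_iff_dvd, ZMod.intCast_eq_intCast_iff_dvd_sub]
    push_cast
    rcases hk3 with h3 | h3 | h3
    · refine Or.inl ⟨trivial, k / 3, ?_⟩
      rw [hq]; linear_combination (2 * (2 * r + 1) : ℤ) * (h3 - hdiv)
    · refine Or.inr (Or.inl ⟨by simp, -(k / 3), ?_⟩)
      rw [hq]; linear_combination (2 * (2 * r + 1) : ℤ) * (hdiv - h3)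
    · refine Or.inr (Or.inr ⟨by simp, -(k / 3), ?_⟩)
      rw [hq]; linear_combination (2 * (2 * r + 1) : ℤ) * (hdiv - h3)
  exact (card_le_card this).trans card_le_three

end Blocks

section Covering

variable {s r : ℕ}

/-- `g` lies in the core subgroup or is a difference of one of the triples. -/
def Covered (s r : ℕ) (g : ZMod (2 * (2 * s + 1)) × ZMod (2 * (6 * r + 3))) : Prop :=
  g ∈ coreSubgroup s r ∨ ∃ x ∈ labels s r, g ∈ tripleDiff (generators s r x)

lemma Covered.neg {g : ZMod (2 * (2 * s + 1)) × ZMod (2 * (6 * r + 3))} (h : Covered s r g) :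
    Covered s r (-g) := by
  rcases h with h | ⟨x, hx, h⟩
  · left
    simp only [coreSubgroup, mem_filter, mem_univ, true_and, Prod.fst_neg, Prod.snd_neg,
      smul_neg, neg_eq_zero] at h ⊢
    exact h
  · exact Or.inr ⟨x, hx, neg_mem_tripleDiff h⟩

lemma covered_neg_iff {a b c i : ℤ} :
    Covered s r (point s r a b (-c) (-i)) ↔ Covered s r (point s r a b c i) := by
  rw [← neg_point']
  exact ⟨fun h => by simpa using h.neg, Covered.neg⟩

lemma covered_core_mul (k : ℤ) : Covered s r (point s r 0 0 0 ((2 * r + 1) * k)) := by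
  left
  simp only [coreSubgroup, mem_filter, mem_univ, true_and, point, one_smul, nsmul_eq_mul]
  refine ⟨by simp, ?_⟩
  rw [← Int.cast_natCast, ← Int.cast_mul, ZMod.intCast_zmod_eq_zero_iff_dvd]
  exact ⟨k, by push_cast; ring⟩

lemma covered_involution {a b : ℤ} (ha : a = 0 ∨ a = 1) (hb : b = 0 ∨ b = 1) :
    Covered s r (point s r a b 0 0) := by
  by_cases h : a = 0 ∧ b = 0
  · rw [h.1, h.2]
    simpa using covered_core_mul (s := s) (r := r) 0
  · refine Or.inr ⟨Sum.inl (), by simp [labels], ?_⟩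
    simp only [generators, tripleDiff, Sum.elim_inl, point_add, mem_insert, mem_singleton]
    rcases ha with rfl | rfl <;> rcases hb with rfl | rfl <;> simp_all

lemma covered_classMod {c i : ℤ} (h1 : 1 ≤ c) (h2 : c ≤ s) :
    Covered s r (point s r (classMod i).1 (classMod i).2 c i) ∧
      Covered s r (point s r 0 0 (2 * c) (2 * i)) := by
  have h3 := Int.emod_nonneg i (show (6 * r + 3 : ℤ) ≠ 0 by omega)
  have h4 := Int.emod_lt_of_pos i (show (0 : ℤ) < 6 * r + 3 by omega)
  have h5 := Int.emod_add_mul_ediv i (6 * r + 3)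
  have hcl : classMod (i % (6 * r + 3)) = classMod i := by
    have : i % (6 * r + 3) % 3 = i % 3 := Int.emod_emod_of_dvd _ ⟨2 * r + 1, by ring⟩
    simp only [classMod, this]
  have hmem : (Sum.inr (Sum.inl (c, i % (6 * r + 3))) : Label) ∈ labels s r := by
    simp [labels, h1, h2, h3, h4]
  refine ⟨Or.inr ⟨_, hmem, ?_⟩, Or.inr ⟨_, hmem, ?_⟩⟩ <;>
    simp only [generators, Sum.elim_inl, Sum.elim_inr, tripleDiff, point_add, mem_insert,
      mem_singleton, hcl]
  · left
    exact point_eq 0 0 0 (i / (6 * r + 3)) (by ring) (by ring) (by ring) (by rw [h5])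
  · right; right; right; right; left
    exact point_eq (-(classMod i).1) (-(classMod i).2) 0 (2 * (i / (6 * r + 3)))
      (by ring) (by ring) (by ring) (by linear_combination -2 * h5)

lemma covered_classInterval {d : ℤ} (h1 : 1 ≤ d) (h2 : d ≤ 3 * r + 1) (h3 : d ≠ 2 * r + 1) :
    Covered s r (point s r (classInterval r d).1 (classInterval r d).2 0 d) ∧
      Covered s r (point s r 0 0 0 (2 * d)) := by
  have hmem : (Sum.inr (Sum.inr (Sum.inl d)) : Label) ∈ labels s r := by
    simp [labels, h1, h2, h3]
  refine ⟨Or.inr ⟨_, hmem, ?_⟩, Or.inr ⟨_, hmem, ?_⟩⟩ <;>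
    simp only [generators, Sum.elim_inl, Sum.elim_inr, tripleDiff, point_add, mem_insert,
      mem_singleton]
  · exact Or.inl trivial
  · right; right; right; right; left
    exact point_eq (-(classInterval r d).1) (-(classInterval r d).2) 0 0
      (by ring) (by ring) (by ring) (by ring)

lemma covered_ascending {c : ℤ} (a : ℤ) (h1 : 1 ≤ c) (h2 : c ≤ s) :
    Covered s r (point s r 0 1 c (3 * a)) ∧ Covered s r (point s r 1 1 c (1 + 3 * a)) ∧
      Covered s r (point s r 1 0 (2 * c) (1 + 6 * a)) := by
  have h3 := Int.emod_nonneg a (show (2 * r + 1 : ℤ) ≠ 0 by omega)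
  have h4 := Int.emod_lt_of_pos a (show (0 : ℤ) < 2 * r + 1 by omega)
  have h5 := Int.emod_add_mul_ediv a (2 * r + 1)
  have hmem : (Sum.inr (Sum.inr (Sum.inr (Sum.inl (c, a % (2 * r + 1))))) : Label) ∈
      labels s r := by
    simp [labels, h1, h2, h3, h4]
  refine ⟨Or.inr ⟨_, hmem, ?_⟩, Or.inr ⟨_, hmem, ?_⟩, Or.inr ⟨_, hmem, ?_⟩⟩ <;>
    simp only [generators, Sum.elim_inl, Sum.elim_inr, tripleDiff, point_add, mem_insert,
      mem_singleton]
  · left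
    exact point_eq 0 0 0 (a / (2 * r + 1)) (by ring) (by ring) (by ring)
      (by linear_combination -3 * h5)
  · right; right; left
    exact point_eq 0 0 0 (a / (2 * r + 1)) (by ring) (by ring) (by ring)
      (by linear_combination -3 * h5)
  · right; right; right; right; left
    exact point_eq 0 (-1) 0 (2 * (a / (2 * r + 1))) (by ring) (by ring) (by ring)
      (by linear_combination -6 * h5)

lemma covered_descending {c : ℤ} (a : ℤ) (h1 : 1 ≤ c) (h2 : c ≤ s) :
    Covered s r (point s r 0 1 c (-1 - 3 * a)) ∧ Covered s r (point s r 1 1 c (-3 * a)) ∧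
      Covered s r (point s r 1 0 (2 * c) (-1 - 6 * a)) := by
  have h3 := Int.emod_nonneg a (show (2 * r + 1 : ℤ) ≠ 0 by omega)
  have h4 := Int.emod_lt_of_pos a (show (0 : ℤ) < 2 * r + 1 by omega)
  have h5 := Int.emod_add_mul_ediv a (2 * r + 1)
  have hmem : (Sum.inr (Sum.inr (Sum.inr (Sum.inr (Sum.inl (c, a % (2 * r + 1)))))) : Label) ∈
      labels s r := by
    simp [labels, h1, h2, h3, h4]
  refine ⟨Or.inr ⟨_, hmem, ?_⟩, Or.inr ⟨_, hmem, ?_⟩, Or.inr ⟨_, hmem, ?_⟩⟩ <;>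
    simp only [generators, Sum.elim_inl, Sum.elim_inr, tripleDiff, point_add, mem_insert,
      mem_singleton]
  · left
    exact point_eq 0 0 0 (-(a / (2 * r + 1))) (by ring) (by ring) (by ring)
      (by linear_combination 3 * h5)
  · right; right; left
    exact point_eq 0 0 0 (-(a / (2 * r + 1))) (by ring) (by ring) (by ring)
      (by linear_combination 3 * h5)
  · right; right; right; right; left
    exact point_eq 0 (-1) 0 (-(2 * (a / (2 * r + 1)))) (by ring) (by ring) (by ring)
      (by linear_combination 6 * h5)

lemma covered_zeroSum {t : ℤ} (h1 : 0 ≤ t) (h2 : t ≤ 2 * r) :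
    Covered s r (point s r 1 0 0 (zeroSum r t).1) ∧
      Covered s r (point s r 0 1 0 (zeroSum r t).2) ∧
      Covered s r (point s r 1 1 0 ((zeroSum r t).1 + (zeroSum r t).2)) := by
  have hmem : (Sum.inr (Sum.inr (Sum.inr (Sum.inr (Sum.inr t)))) : Label) ∈ labels s r := by
    simp only [labels, inr_mem_disjSum, mem_Ico]
    omega
  refine ⟨Or.inr ⟨_, hmem, ?_⟩, Or.inr ⟨_, hmem, ?_⟩, Or.inr ⟨_, hmem, ?_⟩⟩ <;>
    simp only [generators, Sum.elim_inr, tripleDiff, point_add, mem_insert,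
      mem_singleton]
  · exact Or.inl trivial
  · exact Or.inr (Or.inr (Or.inl trivial))
  · right; right; right; right; left
    exact point_eq 0 0 0 0 (by ring) (by ring) (by ring) (by ring)

lemma Covered.congr {a b c i c' i' : ℤ} (h : Covered s r (point s r a b c' i')) (u v : ℤ)
    (hc : c' = c + (2 * s + 1) * u) (hi : i' = i + (6 * r + 3) * v) :
    Covered s r (point s r a b c i) := by
  rwa [point_eq 0 0 u v (by ring) (by ring) hc hi] at h

lemma forall_of_half_range {P : ℤ → ℤ → Prop} (N : ℕ) (hneg : ∀ c i : ℤ, P (-c) (-i) → P c i)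
    (hshift : ∀ c i u : ℤ, P (c + (2 * N + 1) * u) i → P c i)
    (h : ∀ c i : ℤ, 0 ≤ c → c ≤ N → P c i) (c i : ℤ) : P c i := by
  obtain ⟨d, u, h0, h1, h2 | h2⟩ := exists_half_residue N c
  · exact hshift c i u (h2 ▸ h d i h0 h1)
  · exact hneg c i (hshift (-c) (-i) u (h2 ▸ h d (-i) h0 h1))

/-- Covering of the points whose first odd coordinate is zero. -/
lemma covered_zero_left {a b : ℤ} (ha : a = 0 ∨ a = 1) (hb : b = 0 ∨ b = 1)
    (hab : ¬(a = 0 ∧ b = 0)) (i : ℤ) : Covered s r (point s r a b 0 i) := by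
  refine forall_of_half_range (3 * r + 1) (P := fun i _ => Covered s r (point s r a b 0 i))
    (fun i _ h => ?_) (fun i _ u h => h.congr 0 u (by ring) (by push_cast; ring))
    (fun i _ h0 h1 => ?_) i 0
  · rw [← covered_neg_iff]; simpa using h
  replace h1 : i ≤ 3 * r + 1 := by exact_mod_cast h1
  rcases h0.eq_or_lt with rfl | hpos
  · exact covered_involution ha hb
  have hI : i ≠ 2 * r + 1 → classInterval r i = (a, b) → Covered s r (point s r a b 0 i) := by
    intro h2 h3
    have := (covered_classInterval (s := s) hpos h1 h2).1
    rwa [h3] at this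
  rcases ha with rfl | rfl <;> rcases hb with rfl | rfl
  · simp at hab
  · have hY : ∀ t : ℤ, 0 ≤ t → t ≤ 2 * r → (i = (zeroSum r t).2 ∨ -i = (zeroSum r t).2) →
        Covered s r (point s r 0 1 0 i) := by
      rintro t h2 h3 (h4 | h4)
      · exact h4 ▸ (covered_zeroSum h2 h3).2.1
      · rw [← covered_neg_iff, neg_zero, h4]; exact (covered_zeroSum h2 h3).2.1
    rcases lt_trichotomy i r with h2 | h2 | h2
    · refine hY (r + i - 1) (by omega) (by omega) (Or.inr ?_)
      unfold zeroSum; split_ifs <;> simp only <;> omega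
    · refine hY (2 * r - 1) (by omega) (by omega) (Or.inl ?_)
      unfold zeroSum; split_ifs <;> simp only <;> omega
    rcases lt_trichotomy i (2 * r + 1) with h3 | h3 | h3
    · apply hI (by omega)
      unfold classInterval; split_ifs <;> first | rfl | omega
    · refine hY (2 * r) (by omega) (by omega) (Or.inl ?_)
      unfold zeroSum; split_ifs <;> simp only <;> omega
    · refine hY (i - 2 * r - 2) (by omega) (by omega) (Or.inr ?_)
      unfold zeroSum; split_ifs <;> simp only <;> omega
  · have hX : ∀ t : ℤ, 0 ≤ t → t ≤ 2 * r → i = (zeroSum r t).1 →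
        Covered s r (point s r 1 0 0 i) := fun t h2 h3 h4 => h4 ▸ (covered_zeroSum h2 h3).1
    by_cases h2 : i ≤ r
    · apply hI (by omega)
      unfold classInterval; split_ifs; rfl
    by_cases h3 : i = 3 * r + 1
    · refine hX (2 * r) (by omega) (by omega) ?_
      unfold zeroSum; split_ifs <;> simp only <;> omega
    by_cases h4 : i = r + 1
    · refine hX (2 * r - 1) (by omega) (by omega) ?_
      unfold zeroSum; split_ifs <;> simp only <;> omega
    by_cases h5 : (i - r) % 2 = 0
    · refine hX ((i - r - 2) / 2) (by omega) (by omega) ?_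
      unfold zeroSum; split_ifs <;> simp only <;> omega
    · refine hX ((i + r - 3) / 2) (by omega) (by omega) ?_
      unfold zeroSum; split_ifs <;> simp only <;> omega
  · have hZ : ∀ t : ℤ, 0 ≤ t → t ≤ 2 * r → (i = (zeroSum r t).1 + (zeroSum r t).2 ∨
        -i = (zeroSum r t).1 + (zeroSum r t).2 ∨
        -i + (6 * r + 3) = (zeroSum r t).1 + (zeroSum r t).2) →
        Covered s r (point s r 1 1 0 i) := by
      rintro t h2 h3 (h4 | h4 | h4) <;> have h5 := (covered_zeroSum (s := s) h2 h3).2.2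
      · rwa [← h4] at h5
      · rw [← covered_neg_iff, neg_zero]
        rwa [← h4] at h5
      · rw [← covered_neg_iff, neg_zero]
        exact h5.congr 0 1 (by ring) (by rw [← h4]; ring)
    by_cases h2 : i ≤ r
    · refine hZ (r - i) (by omega) (by omega) (Or.inr (Or.inl ?_))
      unfold zeroSum; split_ifs <;> simp only <;> omega
    by_cases h3 : i = r + 1
    · refine hZ (2 * r) (by omega) (by omega) (Or.inr (Or.inr ?_))
      unfold zeroSum; split_ifs <;> simp only <;> omega
    rcases lt_trichotomy i (2 * r + 1) with h4 | h4 | h4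
    · refine hZ (i - 2) (by omega) (by omega) (Or.inl ?_)
      unfold zeroSum; split_ifs <;> simp only <;> omega
    · refine hZ (2 * r - 1) (by omega) (by omega) (Or.inl ?_)
      unfold zeroSum; split_ifs <;> simp only <;> omega
    · apply hI (by omega)
      unfold classInterval; split_ifs <;> first | rfl | omega

lemma covered_zero_zero (c i : ℤ) : Covered s r (point s r 0 0 c i) := by
  suffices H : ∀ c i : ℤ, Covered s r (point s r 0 0 (2 * c) (2 * i)) from
    (H (c * (s + 1)) (i * (3 * r + 2))).congr c i (by ring) (by ring)
  refine forall_of_half_range s (fun c i h => ?_)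
    (fun c i u h => h.congr (2 * u) 0 (by ring) (by ring)) fun c i h0 h1 => ?_
  · rw [← covered_neg_iff]; simpa using h
  rcases h0.eq_or_lt with rfl | hpos
  · refine forall_of_half_range (3 * r + 1)
      (P := fun i _ => Covered s r (point s r 0 0 (2 * 0) (2 * i))) (fun c _ h => ?_)
      (fun c _ u h => h.congr 0 (2 * u) (by ring) (by push_cast; ring)) (fun d _ h0 h1 => ?_) i 0
    · rw [← covered_neg_iff]; simpa using h
    rw [mul_zero]
    rcases h0.eq_or_lt with rfl | hpos
    · simpa using covered_core_mul (s := s) (r := r) 0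
    by_cases hd : d = 2 * r + 1
    · rw [hd, mul_comm]
      exact covered_core_mul 2
    · exact (covered_classInterval hpos (by exact_mod_cast h1) hd).2
  · exact (covered_classMod hpos h1).2

lemma covered_one_zero (c i : ℤ) : Covered s r (point s r 1 0 c i) := by
  by_cases h3 : i % 3 = 0
  · refine forall_of_half_range s (P := fun c i => i % 3 = 0 → Covered s r (point s r 1 0 c i))
      (fun c i h hi => ?_) (fun c i u h hi => (h hi).congr u 0 (by ring) (by ring))
      (fun c i h0 h1 hi => ?_) c i h3
    · rw [← covered_neg_iff]; exact h (by omega)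
    rcases h0.eq_or_lt with rfl | hpos
    · exact covered_zero_left (by simp) (by simp) (by simp) i
    have := (covered_classMod (r := r) (i := i) hpos h1).1
    rwa [show classMod i = (1, 0) by simp [classMod, hi]] at this
  · suffices H : ∀ c i : ℤ, i % 3 ≠ 0 → Covered s r (point s r 1 0 (2 * c) i) from
      (H (c * (s + 1)) i h3).congr c 0 (by ring) (by ring)
    refine forall_of_half_range s (fun c i h hi => ?_)
      (fun c i u h hi => (h hi).congr (2 * u) 0 (by ring) (by ring)) (fun c i h0 h1 hi => ?_)
    · rw [← covered_neg_iff, ← mul_neg]; exact h (by omega)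
    rcases h0.eq_or_lt with rfl | hpos
    · exact covered_zero_left (by simp) (by simp) (by simp) i
    have hi3 : i % 3 = 1 ∨ i % 3 = 2 := by omega
    rcases hi3 with hi3 | hi3
    · obtain ⟨b, rfl⟩ : ∃ b, i = 1 + 3 * b := ⟨i / 3, by omega⟩
      exact (covered_ascending (b * (r + 1)) hpos h1).2.2.congr 0 b (by ring) (by ring)
    · obtain ⟨b, rfl⟩ : ∃ b, i = -1 - 3 * b := ⟨-(i / 3) - 1, by omega⟩
      exact (covered_descending (b * (r + 1)) hpos h1).2.2.congr 0 (-b) (by ring) (by ring)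

lemma covered_right_one {a : ℤ} (ha : a = 0 ∨ a = 1) (c i : ℤ) :
    Covered s r (point s r a 1 c i) := by
  refine forall_of_half_range s (P := fun c i => Covered s r (point s r a 1 c i))
    (fun c i h => ?_) (fun c i u h => h.congr u 0 (by ring) (by ring)) (fun c i h0 h1 => ?_) c i
  · rwa [← covered_neg_iff]
  rcases h0.eq_or_lt with rfl | hpos
  · exact covered_zero_left ha (by simp) (by simp) i
  have hcl := (covered_classMod (r := r) (i := i) hpos h1).1
  have hi3 : i % 3 = 0 ∨ i % 3 = 1 ∨ i % 3 = 2 := by omega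
  rcases ha with rfl | rfl <;> rcases hi3 with hi | hi | hi
  · obtain ⟨b, rfl⟩ : ∃ b, i = 3 * b := ⟨i / 3, by omega⟩
    exact (covered_ascending b hpos h1).1
  · rwa [show classMod i = (0, 1) by simp [classMod, hi]] at hcl
  · obtain ⟨b, rfl⟩ : ∃ b, i = -1 - 3 * b := ⟨-(i / 3) - 1, by omega⟩
    exact (covered_descending b hpos h1).1
  · obtain ⟨b, rfl⟩ : ∃ b, i = -3 * b := ⟨-(i / 3), by omega⟩
    exact (covered_descending b hpos h1).2.1
  · obtain ⟨b, rfl⟩ : ∃ b, i = 1 + 3 * b := ⟨i / 3, by omega⟩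
    exact (covered_ascending b hpos h1).2.1
  · rwa [show classMod i = (1, 1) by simp [classMod, hi]] at hcl

theorem covered_all (g : ZMod (2 * (2 * s + 1)) × ZMod (2 * (6 * r + 3))) : Covered s r g := by
  obtain ⟨a, b, c, i, ha, rfl | rfl, rfl⟩ := exists_point_eq g
  · rcases ha with rfl | rfl
    · exact covered_zero_zero c i
    · exact covered_one_zero c i
  · exact covered_right_one ha c i

end Covering

theorem stmt18 (m n : ℕ) (hm : 0 < m) (hn : 0 < n)
    (hm12 : m % 12 = 2 ∨ m % 12 = 10) (hn12 : n % 12 = 6) :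
    ∃ F : Finset (Finset (ZMod m × ZMod n)),
      OOSPC m n 3 2 1 F ∧ Regular m n 1 3 F ∧ F.card = (5 * m * n - 12) / 24 := by
  obtain ⟨s, rfl⟩ : ∃ s, m = 2 * (2 * s + 1) := ⟨m / 4, by omega⟩
  obtain ⟨r, rfl⟩ : ∃ r, n = 2 * (6 * r + 3) := ⟨n / 12, by omega⟩
  have hcard : (coreSubgroup s r)ᶜ.card ≥ 12 * (2 * s + 1) * (2 * r + 1) - 3 := by
    have h := card_coreSubgroup_le s r
    rw [card_compl, Fintype.card_prod, ZMod.card, ZMod.card,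
      show 2 * (2 * s + 1) * (2 * (6 * r + 3)) = 12 * (2 * s + 1) * (2 * r + 1) by ring]
    omega
  obtain ⟨F, h1, h2, h3⟩ := exists_OOSPC_of_cover (T := coreSubgroup s r)
    (fun p => by simp [coreSubgroup]) (fun x _ => three_le_weight x)
    (fun x _ => card_tripleDiff_generators_le s r x) ((sum_weight s r).trans_le hcard)
    (fun g hg => (covered_all g).resolve_left hg)
  refine ⟨F, h1, h2, ?_⟩
  rw [h3, card_labels]
  have : 5 * (2 * (2 * s + 1)) * (2 * (6 * r + 3)) - 12 =
      24 * (5 * s * (2 * r + 1) + 5 * r + 2) := by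
    apply Nat.sub_eq_of_eq_add
    ring
  rw [this]
  omega
end

section
/- For all positive integers m and n with m ≡ 1 or 5 (mod 6) and n ≡ 3 (mod 6), with (m,n) ≠ (1,9), there exists a (1,3)-regular (m,n,3,1,1)-OOSPC. -/
open Finset

/-- The six differences, up to sign, of the block `{0, a, a + b}` attached to `t = (a, b)`
contain `g`. -/
def BlockDiff {G : Type*} [AddCommGroup G] (t : G × G) (g : G) : Prop :=
  (g = t.1 ∨ g = t.2 ∨ g = t.1 + t.2) ∨ (-g = t.1 ∨ -g = t.2 ∨ -g = t.1 + t.2)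

/-- The group `G` has at most `(|G| - 3) / 6` triples `0, a, a + b` whose differences cover all
elements of `G` not annihilated by `3`. When the `3`-torsion of `G` has order `3` this is a
relative difference family. -/
def HasTripleCover (G : Type*) [AddCommGroup G] : Prop :=
  ∃ T : Finset (G × G), 6 * T.card + 3 ≤ Nat.card G ∧
    ∀ g : G, 3 • g ≠ 0 → ∃ t ∈ T, BlockDiff t g

/-- The `3`-torsion of `G` is contained in `{0, τ, -τ}`. -/
def ThreeTorsionIn {G : Type*} [AddCommGroup G] (τ : G) : Prop :=
  ∀ g : G, 3 • g = 0 → g = 0 ∨ g = τ ∨ g = -τ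

theorem BlockDiff.neg {G : Type*} [AddCommGroup G] {t : G × G} {g : G} (h : BlockDiff t g) :
    BlockDiff t (-g) := by
  unfold BlockDiff at *
  rw [neg_neg]
  exact h.symm

theorem HasTripleCover.of_addEquiv {G H : Type*} [AddCommGroup G] [AddCommGroup H]
    (e : G ≃+ H) (hG : HasTripleCover G) : HasTripleCover H := by
  classical
  obtain ⟨T, hT, hc⟩ := hG
  refine ⟨T.image (fun t => (e t.1, e t.2)), ?_, fun g hg => ?_⟩
  · have := card_image_le (s := T) (f := fun t => (e t.1, e t.2))
    rw [← Nat.card_congr e.toEquiv]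
    omega
  · obtain ⟨t, ht, h⟩ := hc (e.symm g) (by
      intro h0
      apply hg
      have := congrArg e h0
      simpa using this)
    refine ⟨_, mem_image_of_mem _ ht, ?_⟩
    unfold BlockDiff at *
    simpa only [← map_neg, ← map_add, e.symm_apply_eq] using h

theorem ZMod.two_mul_surjective {m : ℕ} (hm : m % 2 = 1) (h : ZMod m) : ∃ x, h = x + x := by
  refine ⟨h * ((m + 1) / 2 : ℕ), ?_⟩
  have h1 : (((m + 1) / 2 : ℕ) : ZMod m) + ((m + 1) / 2 : ℕ) = 1 := by
    rw [← Nat.cast_add, show (m + 1) / 2 + (m + 1) / 2 = m + 1 by omega]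
    simp
  rw [← mul_add, h1, mul_one]

theorem ZMod.exists_eq_natCast_or_neg {m : ℕ} [NeZero m] (h : ZMod m) :
    ∃ i : ℕ, i ≤ m / 2 ∧ (h = i ∨ h = -i) := by
  refine ⟨h.valMinAbs.natAbs, h.natAbs_valMinAbs_le, ?_⟩
  rcases Int.natAbs_eq h.valMinAbs with h' | h' <;> [left; right] <;>
  · conv_lhs => rw [← h.coe_valMinAbs, h']
    simp

theorem HasTripleCover.zmod_prod {m : ℕ} (hm : m % 2 = 1) {K : Type*} [AddCommGroup K]
    {τ : K} (hτ : ThreeTorsionIn τ) (hK : HasTripleCover K) : HasTripleCover (ZMod m × K) := by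
  classical
  have : NeZero m := ⟨by omega⟩
  obtain ⟨T, hT, hc⟩ := hK
  refine ⟨(univ ×ˢ T).image (fun p : ZMod m × (K × K) => ((p.1, p.2.1), (p.1, p.2.2))) ∪
    (Icc 1 ((m - 1) / 2)).image (fun i : ℕ => ((-i - i, 0), (i, τ))), ?_, fun g hg => ?_⟩
  · have h1 := card_union_le
      ((univ ×ˢ T).image (fun p : ZMod m × (K × K) => ((p.1, p.2.1), (p.1, p.2.2))))
      ((Icc 1 ((m - 1) / 2)).image
        (fun i : ℕ => (((-i - i, 0), (i, τ)) : (ZMod m × K) × (ZMod m × K))))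
    have h2 := card_image_le (s := (univ : Finset (ZMod m)) ×ˢ T)
      (f := fun p : ZMod m × (K × K) => ((p.1, p.2.1), (p.1, p.2.2)))
    have h3 := card_image_le (s := Icc 1 ((m - 1) / 2))
      (f := fun i : ℕ => (((-i - i, 0), (i, τ)) : (ZMod m × K) × (ZMod m × K)))
    rw [card_product, card_univ, ZMod.card] at h2
    rw [Nat.card_Icc] at h3
    rw [Nat.card_prod, Nat.card_zmod]
    have h4 := Nat.mul_le_mul_left m hT
    have h5 : m * (6 * T.card + 3) = 6 * (m * T.card) + 3 * m := by ring
    omega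
  · obtain ⟨h, k⟩ := g
    by_cases hk : 3 • k = 0
    · have h0 : h ≠ 0 := by
        rintro rfl
        exact hg (by simp [hk])
      have key : ∀ x : ZMod m, x ≠ 0 →
          ∃ i ∈ Icc 1 ((m - 1) / 2), x = (i : ℕ) ∨ x = -(i : ℕ) := by
        intro x hx
        obtain ⟨i, hi, hxi⟩ := ZMod.exists_eq_natCast_or_neg x
        refine ⟨i, ?_, hxi⟩
        rw [mem_Icc]
        have : i ≠ 0 := by
          rintro rfl
          exact hx (by simpa using hxi)
        omega
      rcases hτ k hk with rfl | rfl | rfl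
      · obtain ⟨x, rfl⟩ := ZMod.two_mul_surjective hm h
        obtain ⟨i, hi, hxi⟩ := key x (by rintro rfl; exact h0 (by simp))
        refine ⟨_, mem_union_right _ (mem_image_of_mem _ hi), ?_⟩
        rcases hxi with rfl | rfl
        · refine Or.inr (Or.inl ?_)
          ext <;> simp [sub_eq_add_neg]
        · refine Or.inl (Or.inl ?_)
          ext <;> simp [sub_eq_add_neg]
      · obtain ⟨i, hi, hxi⟩ := key h h0
        refine ⟨_, mem_union_right _ (mem_image_of_mem _ hi), ?_⟩
        rcases hxi with rfl | rfl
        · exact Or.inl (Or.inr (Or.inl rfl))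
        · refine Or.inl (Or.inr (Or.inr ?_))
          ext <;> simp
      · obtain ⟨i, hi, hxi⟩ := key h h0
        refine ⟨_, mem_union_right _ (mem_image_of_mem _ hi), ?_⟩
        rcases hxi with rfl | rfl
        · refine Or.inr (Or.inr (Or.inr ?_))
          ext <;> simp
        · refine Or.inr (Or.inr (Or.inl ?_))
          ext <;> simp
    · obtain ⟨t, ht, hd⟩ := hc k hk
      have key : ∀ x : ZMod m, BlockDiff ((x, t.1), (x, t.2)) (h, k) →
          ∃ t' ∈ (univ ×ˢ T).image
            (fun p : ZMod m × (K × K) => ((p.1, p.2.1), (p.1, p.2.2))) ∪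
            (Icc 1 ((m - 1) / 2)).image (fun i : ℕ => ((-i - i, 0), (i, τ))),
            BlockDiff t' (h, k) := fun x hx =>
        ⟨_, mem_union_left _
          (mem_image_of_mem _ (mk_mem_product (mem_univ x) ht)), hx⟩
      obtain ⟨x, hx⟩ := ZMod.two_mul_surjective hm h
      rcases hd with (hd | hd | hd) | (hd | hd | hd)
      · exact key h (by simp [BlockDiff, hd])
      · exact key h (by simp [BlockDiff, hd])
      · exact key x (by simp [BlockDiff, hd, hx])
      · exact key (-h) (by simp [BlockDiff, hd])
      · exact key (-h) (by simp [BlockDiff, hd])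
      · exact key (-x) (by simp [BlockDiff, hd, hx])

theorem hasTripleCover_zmod_of_nat {n : ℕ} (hn : n % 2 = 1) (T : Finset (ℕ × ℕ))
    (hT : 6 * T.card + 3 ≤ n)
    (hc : ∀ d, 1 ≤ d → d ≤ n / 2 → 3 * d ≠ n →
      ∃ t ∈ T, d = t.1 ∨ d = t.2 ∨ d = t.1 + t.2 ∨ d + (t.1 + t.2) = n) :
    HasTripleCover (ZMod n) := by
  have : NeZero n := ⟨by omega⟩
  refine ⟨T.image (fun t => ((t.1 : ZMod n), (t.2 : ZMod n))), ?_, fun g hg => ?_⟩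
  · have := card_image_le (s := T) (f := fun t => ((t.1 : ZMod n), (t.2 : ZMod n)))
    rw [Nat.card_zmod]
    omega
  · have key : ∀ d : ℕ, d ≤ n / 2 → 3 • (d : ZMod n) ≠ 0 →
        ∃ t ∈ T.image (fun t => ((t.1 : ZMod n), (t.2 : ZMod n))), BlockDiff t (d : ZMod n) := by
      intro d hd h3
      obtain ⟨t, ht, h⟩ := hc d
        (Nat.one_le_iff_ne_zero.2 (by rintro rfl; simp at h3)) hd (by
          rintro rfl
          apply h3
          rw [nsmul_eq_mul, ← Nat.cast_mul, ZMod.natCast_self])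
      refine ⟨_, mem_image_of_mem _ ht, ?_⟩
      rcases h with h | h | h | h
      · exact Or.inl (Or.inl (by rw [h]))
      · exact Or.inl (Or.inr (Or.inl (by rw [h])))
      · exact Or.inl (Or.inr (Or.inr (by rw [h, Nat.cast_add])))
      · refine Or.inr (Or.inr (Or.inr ?_))
        rw [neg_eq_iff_add_eq_zero]
        have := congrArg (Nat.cast : ℕ → ZMod n) h
        simpa using this
    obtain ⟨d, hd, rfl | rfl⟩ := ZMod.exists_eq_natCast_or_neg g
    · exact key d hd hg
    · obtain ⟨t, ht, h⟩ := key d hd (by simpa using hg)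
      exact ⟨t, ht, h.neg⟩

/-- Peltesohn's difference triples for `v = 18 s + 9` with `3 ≤ s`. -/
def peltesohnTriples (s : ℕ) : Finset (ℕ × ℕ) :=
  (range (s + 1)).image (fun r => (3 * r + 1, 4 * s + 3 - r)) ∪
  (Ico 2 (s - 1)).image (fun r => (3 * r + 2, 8 * s + 2 - r)) ∪
  (Ico 1 (s - 1)).image (fun r => (3 * r + 3, 6 * s + 1 - 2 * r)) ∪
  {(2, 8 * s + 3), (3, 8 * s + 1), (5, 8 * s + 2), (3 * s - 1, 3 * s + 2), (3 * s, 7 * s + 3)}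

theorem card_peltesohnTriples_le {s : ℕ} (hs : 3 ≤ s) :
    (peltesohnTriples s).card ≤ 3 * s + 1 := by
  unfold peltesohnTriples
  refine (card_union_le _ _).trans ?_
  refine (Nat.add_le_add ((card_union_le _ _).trans
    (Nat.add_le_add ((card_union_le _ _).trans
      (Nat.add_le_add card_image_le card_image_le)) card_image_le)) card_le_five).trans ?_
  simp only [card_range, Nat.card_Ico]
  omega

theorem peltesohnTriples_cover {s d : ℕ} (hs : 3 ≤ s) (h1 : 1 ≤ d) (h2 : d ≤ 9 * s + 4)
    (h3 : d ≠ 6 * s + 3) :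
    ∃ t ∈ peltesohnTriples s,
      d = t.1 ∨ d = t.2 ∨ d = t.1 + t.2 ∨ d + (t.1 + t.2) = 18 * s + 9 := by
  have hA : ∀ r, r ≤ s → (3 * r + 1, 4 * s + 3 - r) ∈ peltesohnTriples s := fun r hr => by
    refine mem_union_left _ (mem_union_left _ (mem_union_left _ (mem_image.2 ⟨r, ?_, rfl⟩)))
    rw [mem_range]; omega
  have hB : ∀ r, 2 ≤ r → r + 2 ≤ s → (3 * r + 2, 8 * s + 2 - r) ∈ peltesohnTriples s :=
    fun r hr hr' => by
      refine mem_union_left _ (mem_union_left _ (mem_union_right _ (mem_image.2 ⟨r, ?_, rfl⟩)))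
      rw [mem_Ico]; omega
  have hC : ∀ r, 1 ≤ r → r + 2 ≤ s → (3 * r + 3, 6 * s + 1 - 2 * r) ∈ peltesohnTriples s :=
    fun r hr hr' => by
      refine mem_union_left _ (mem_union_right _ (mem_image.2 ⟨r, ?_, rfl⟩))
      rw [mem_Ico]; omega
  have hE : ∀ t ∈ ({(2, 8 * s + 3), (3, 8 * s + 1), (5, 8 * s + 2), (3 * s - 1, 3 * s + 2),
      (3 * s, 7 * s + 3)} : Finset (ℕ × ℕ)), t ∈ peltesohnTriples s :=
    fun t ht => mem_union_right _ ht
  by_cases hE1 : d = 2 ∨ d = 8 * s + 3 ∨ d = 8 * s + 5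
  · exact ⟨_, hE (2, 8 * s + 3) (by simp), by dsimp only; omega⟩
  by_cases hE2 : d = 3 ∨ d = 8 * s + 1 ∨ d = 8 * s + 4
  · exact ⟨_, hE (3, 8 * s + 1) (by simp), by dsimp only; omega⟩
  by_cases hE3 : d = 5 ∨ d = 8 * s + 2 ∨ d = 8 * s + 7
  · exact ⟨_, hE (5, 8 * s + 2) (by simp), by dsimp only; omega⟩
  by_cases hE4 : d = 3 * s - 1 ∨ d = 3 * s + 2 ∨ d = 6 * s + 1
  · exact ⟨_, hE (3 * s - 1, 3 * s + 2) (by simp), by dsimp only; omega⟩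
  by_cases hE5 : d = 3 * s ∨ d = 7 * s + 3 ∨ d = 8 * s + 6
  · exact ⟨_, hE (3 * s, 7 * s + 3) (by simp), by dsimp only; omega⟩
  by_cases c1 : d ≤ 3 * s + 1
  · have : d % 3 = 0 ∨ d % 3 = 1 ∨ d % 3 = 2 := by omega
    rcases this with h | h | h
    · exact ⟨_, hC (d / 3 - 1) (by omega) (by omega), by dsimp only; omega⟩
    · exact ⟨_, hA (d / 3) (by omega), by dsimp only; omega⟩
    · exact ⟨_, hB (d / 3) (by omega) (by omega), by dsimp only; omega⟩
  by_cases c2 : d ≤ 4 * s + 3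
  · exact ⟨_, hA (4 * s + 3 - d) (by omega), by dsimp only; omega⟩
  by_cases c3 : d ≤ 6 * s + 4
  · rcases Nat.even_or_odd' d with ⟨e, rfl | rfl⟩
    · exact ⟨_, hA (e - 2 * s - 2) (by omega), by dsimp only; omega⟩
    · exact ⟨_, hC (3 * s - e) (by omega) (by omega), by dsimp only; omega⟩
  by_cases c4 : d ≤ 7 * s + 2
  · exact ⟨_, hC (d - 6 * s - 4) (by omega) (by omega), by dsimp only; omega⟩
  by_cases c5 : d ≤ 8 * s
  · exact ⟨_, hB (8 * s + 2 - d) (by omega) (by omega), by dsimp only; omega⟩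
  rcases Nat.even_or_odd' d with ⟨e, rfl | rfl⟩
  · exact ⟨_, hB (e - 4 * s - 2) (by omega) (by omega), by dsimp only; omega⟩
  · exact ⟨_, hB (5 * s + 2 - e) (by omega) (by omega), by dsimp only; omega⟩

theorem hasTripleCover_zmod_of_nine_dvd {n : ℕ} (hn : n % 18 = 9) (h9 : n ≠ 9) :
    HasTripleCover (ZMod n) := by
  obtain ⟨s, rfl⟩ : ∃ s, n = 18 * s + 9 := ⟨n / 18, by omega⟩
  by_cases hs : 3 ≤ s
  · have := card_peltesohnTriples_le hs
    refine hasTripleCover_zmod_of_nat (by omega) (peltesohnTriples s) (by omega) ?_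
    intro d h1 h2 h3
    exact peltesohnTriples_cover hs h1 (by omega) (by omega)
  · obtain rfl | rfl : s = 1 ∨ s = 2 := by omega
    · refine hasTripleCover_zmod_of_nat (by norm_num)
        {(1, 12), (3, 8), (4, 6), (2, 5)} (by decide) ?_
      intro d h1 h2 h3
      norm_num at h2
      interval_cases d <;> revert h3 <;> decide
    · refine hasTripleCover_zmod_of_nat (by norm_num)
        {(1, 21), (2, 18), (5, 14), (6, 11), (7, 9), (3, 10), (4, 8)} (by decide) ?_
      intro d h1 h2 h3
      norm_num at h2
      interval_cases d <;> revert h3 <;> decide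

theorem threeTorsionIn_zmod {n s : ℕ} (hs : 0 < s) (hn : n = 3 * s) :
    ThreeTorsionIn (s : ZMod n) := by
  intro k hk
  subst hn
  have : NeZero (3 * s) := ⟨by omega⟩
  rw [← ZMod.natCast_zmod_val k, nsmul_eq_mul, ← Nat.cast_mul, ZMod.natCast_eq_zero_iff,
    Nat.mul_dvd_mul_iff_left (by norm_num)] at hk
  obtain ⟨q, hq⟩ := hk
  have hlt := k.val_lt
  have hq3 : q < 3 := by
    rw [hq] at hlt
    by_contra! h
    nlinarith
  rw [← ZMod.natCast_zmod_val k, hq]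
  interval_cases q
  · simp
  · simp
  · refine Or.inr (Or.inr ?_)
    rw [eq_neg_iff_add_eq_zero, ← Nat.cast_add, ZMod.natCast_eq_zero_iff]
    exact ⟨1, by ring⟩

theorem ZMod.three_nsmul_eq_zero_iff {m : ℕ} (hm : Nat.Coprime 3 m) (h : ZMod m) :
    3 • h = 0 ↔ h = 0 := by
  have h3 : IsUnit ((3 : ℕ) : ZMod m) := (ZMod.isUnit_iff_coprime 3 m).2 hm
  rw [nsmul_eq_mul, h3.mul_right_eq_zero]

theorem ThreeTorsionIn.zmod_prod {m : ℕ} (hm : Nat.Coprime 3 m) {K : Type*} [AddCommGroup K]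
    {τ : K} (hτ : ThreeTorsionIn τ) : ThreeTorsionIn ((0, τ) : ZMod m × K) := by
  rintro ⟨h, k⟩ hg
  have h1 : 3 • h = 0 := congrArg Prod.fst hg
  have h2 : 3 • k = 0 := congrArg Prod.snd hg
  rw [ZMod.three_nsmul_eq_zero_iff hm] at h1
  subst h1
  rcases hτ k h2 with rfl | rfl | rfl <;> simp

theorem hasTripleCover_zmod_three_mul {s : ℕ} (hs : s % 2 = 1) (h3 : Nat.Coprime s 3) :
    HasTripleCover (ZMod (s * 3)) := by
  have h0 : HasTripleCover (ZMod 3) :=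
    hasTripleCover_zmod_of_nat (by norm_num) ∅ (by simp) (by omega)
  exact (h0.zmod_prod hs (threeTorsionIn_zmod one_pos rfl)).of_addEquiv
    (ZMod.chineseRemainder h3).symm.toAddEquiv

theorem hasTripleCover_zmod_prod_zmod {m n : ℕ} (hm : m % 6 = 1 ∨ m % 6 = 5) (hn : n % 6 = 3)
    (hne : (m, n) ≠ (1, 9)) : HasTripleCover (ZMod m × ZMod n) := by
  have hm3 : Nat.Coprime m 3 := by
    rw [Nat.coprime_comm, Nat.Prime.coprime_iff_not_dvd Nat.prime_three]
    omega
  by_cases h9 : n = 9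
  · subst h9
    have hm1 : m ≠ 1 := fun h => hne (by rw [h])
    have h : HasTripleCover (ZMod (m * 9)) :=
      hasTripleCover_zmod_of_nine_dvd (by omega) (by omega)
    exact h.of_addEquiv
      (ZMod.chineseRemainder (Nat.Coprime.pow_right 2 hm3 : Nat.Coprime m (3 ^ 2))).toAddEquiv
  · refine HasTripleCover.zmod_prod (by omega)
      (threeTorsionIn_zmod (s := n / 3) (by omega) (by omega)) ?_
    by_cases hd : 9 ∣ n
    · exact hasTripleCover_zmod_of_nine_dvd (by omega) h9
    · have h3 : Nat.Coprime (n / 3) 3 := by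
        rw [Nat.coprime_comm, Nat.Prime.coprime_iff_not_dvd Nat.prime_three]
        omega
      have := hasTripleCover_zmod_three_mul (by omega) h3
      rwa [show n / 3 * 3 = n by omega] at this

/-- The six ordered pairs of distinct positions in the block `{0, a, a + b}`. -/
def blockPair {G : Type*} [AddCommGroup G] (t : G × G) : Fin 6 → G × G :=
  ![(t.1, 0), (t.1 + t.2, t.1), (t.1 + t.2, 0), (0, t.1), (t.1, t.1 + t.2), (0, t.1 + t.2)]

theorem BlockDiff.exists_blockPair {G : Type*} [AddCommGroup G] {t : G × G} {g : G}
    (h : BlockDiff t g) : ∃ i, (blockPair t i).1 - (blockPair t i).2 = g := by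
  rcases h with (h | h | h) | (h | h | h)
  · exact ⟨0, by simp [blockPair, h]⟩
  · exact ⟨1, by simp [blockPair, h]⟩
  · exact ⟨2, by simp [blockPair, h]⟩
  · exact ⟨3, by simp [blockPair, ← h]⟩
  · exact ⟨4, by simp [blockPair, ← h]⟩
  · exact ⟨5, by simp only [blockPair]; rw [← neg_neg g, h]; simp⟩

theorem exists_blockPair_of_mem {G : Type*} [AddCommGroup G] [DecidableEq G] {t : G × G} {x y : G}
    (hx : x ∈ ({0, t.1, t.1 + t.2} : Finset G)) (hy : y ∈ ({0, t.1, t.1 + t.2} : Finset G))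
    (hxy : x ≠ y) : ∃ i, blockPair t i = (x, y) := by
  simp only [mem_insert, mem_singleton] at hx hy
  rcases hx with rfl | rfl | rfl <;> rcases hy with rfl | rfl | rfl
  · exact absurd rfl hxy
  · exact ⟨3, rfl⟩
  · exact ⟨5, rfl⟩
  · exact ⟨0, rfl⟩
  · exact absurd rfl hxy
  · exact ⟨4, rfl⟩
  · exact ⟨2, rfl⟩
  · exact ⟨1, rfl⟩
  · exact absurd rfl hxy

theorem blockPair_mem {G : Type*} [AddCommGroup G] [DecidableEq G] (t : G × G) (i : Fin 6) :
    (blockPair t i).1 ∈ ({0, t.1, t.1 + t.2} : Finset G) ∧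
      (blockPair t i).2 ∈ ({0, t.1, t.1 + t.2} : Finset G) := by
  fin_cases i <;> simp [blockPair]

/-- A triple cover of a group with `3`-torsion of order at most `3` is a family of triples in
which every element outside the `3`-torsion is a difference exactly once, and no nonzero
element of the `3`-torsion is a difference. -/
theorem HasTripleCover.exists_family {G : Type*} [AddCommGroup G] [Fintype G] [DecidableEq G]
    (hG : HasTripleCover G) {τ : G} (hτ : ThreeTorsionIn τ) :
    ∃ F : Finset (Finset G), (∀ X ∈ F, X.card = 3) ∧
      (∀ X ∈ F, ∀ Y ∈ F, ∀ x ∈ X, ∀ y ∈ X, ∀ x' ∈ Y, ∀ y' ∈ Y,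
        x ≠ y → x - y = x' - y' → X = Y ∧ x = x') ∧
      ∀ g : G, 3 • g ≠ 0 ↔ g ≠ 0 ∧ ∃ X ∈ F, ∃ x ∈ X, ∃ y ∈ X, x - y = g := by
  obtain ⟨T, hT, hc⟩ := hG
  let φ : (G × G) × Fin 6 → G := fun p => (blockPair p.1 p.2).1 - (blockPair p.1 p.2).2
  let A : Finset G := univ.filter fun g => 3 • g ≠ 0
  have hcov : A ⊆ (T ×ˢ univ).image φ := by
    intro g hg
    obtain ⟨t, ht, h⟩ := hc g (mem_filter.1 hg).2
    obtain ⟨i, hi⟩ := h.exists_blockPair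
    exact mem_image.2 ⟨(t, i), mk_mem_product ht (mem_univ i), hi⟩
  have hcompl : (univ.filter fun g : G => ¬ 3 • g ≠ 0).card ≤ 3 := by
    refine (card_le_card (t := {0, τ, -τ}) fun g hg => ?_).trans card_le_three
    have := hτ g (not_not.1 (mem_filter.1 hg).2)
    simpa using this
  have hsum : A.card + (univ.filter fun g : G => ¬ 3 • g ≠ 0).card = Nat.card G := by
    rw [card_filter_add_card_filter_not, card_univ, Nat.card_eq_fintype_card]
  have hdom : (T ×ˢ (univ : Finset (Fin 6))).card = T.card * 6 := by simp
  have hle := card_image_le (s := T ×ˢ (univ : Finset (Fin 6))) (f := φ)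
  have himg : A = (T ×ˢ univ).image φ := eq_of_subset_of_card_le hcov (by omega)
  have hinj : Set.InjOn φ (T ×ˢ (univ : Finset (Fin 6)) : Finset _) := by
    rw [← card_image_iff]
    have := card_le_card hcov
    omega
  have hφ : ∀ t ∈ T, ∀ i, 3 • φ (t, i) ≠ 0 := by
    intro t ht i
    have : φ (t, i) ∈ A := himg ▸ mem_image_of_mem φ (mk_mem_product ht (mem_univ i))
    exact (mem_filter.1 this).2
  have hφ0 : ∀ t ∈ T, ∀ i, φ (t, i) ≠ 0 := fun t ht i h => hφ t ht i (by rw [h, smul_zero])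
  refine ⟨T.image fun t => {0, t.1, t.1 + t.2}, ?_, ?_, ?_⟩
  · intro X hX
    obtain ⟨t, ht, rfl⟩ := mem_image.1 hX
    have h0 := hφ0 t ht 0
    have h1 := hφ0 t ht 1
    have h2 := hφ0 t ht 2
    simp only [φ, blockPair] at h0 h1 h2
    simp at h0 h1 h2
    rw [card_eq_three]
    exact ⟨0, t.1, t.1 + t.2, Ne.symm h0, Ne.symm h2, by simpa using h1, rfl⟩
  · intro X hX Y hY x hx y hy x' hx' y' hy' hxy hd
    obtain ⟨t, ht, rfl⟩ := mem_image.1 hX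
    obtain ⟨t', ht', rfl⟩ := mem_image.1 hY
    have hxy' : x' ≠ y' := by
      rw [← sub_ne_zero, ← hd, sub_ne_zero]
      exact hxy
    obtain ⟨i, hi⟩ := exists_blockPair_of_mem hx hy hxy
    obtain ⟨i', hi'⟩ := exists_blockPair_of_mem hx' hy' hxy'
    have h := hinj (mem_coe.2 (mk_mem_product ht (mem_univ i)))
      (mem_coe.2 (mk_mem_product ht' (mem_univ i')))
      (by simp only [φ, hi, hi', hd])
    obtain ⟨rfl, rfl⟩ := Prod.mk.inj h
    exact ⟨rfl, congrArg Prod.fst (hi.symm.trans hi')⟩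
  · intro g
    constructor
    · intro hg
      refine ⟨fun h => hg (by rw [h, smul_zero]), ?_⟩
      obtain ⟨t, ht, h⟩ := hc g hg
      obtain ⟨i, hi⟩ := h.exists_blockPair
      exact ⟨_, mem_image_of_mem _ ht, _, (blockPair_mem t i).1, _, (blockPair_mem t i).2, hi⟩
    · rintro ⟨hg, X, hX, x, hx, y, hy, rfl⟩
      obtain ⟨t, ht, rfl⟩ := mem_image.1 hX
      obtain ⟨i, hi⟩ := exists_blockPair_of_mem hx hy (sub_ne_zero.1 hg)
      simpa only [φ, hi] using hφ t ht i

theorem card_inter_image_add_le_one {G : Type*} [AddCommGroup G] [DecidableEq G] {X Y : Finset G}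
    {g : G} (h : ∀ x ∈ X, ∀ y ∈ X, x - g ∈ Y → y - g ∈ Y → x = y) :
    (X ∩ Y.image fun x => g + x).card ≤ 1 := by
  rw [card_le_one]
  intro x hx y hy
  obtain ⟨hx, hx'⟩ := mem_inter.1 hx
  obtain ⟨hy, hy'⟩ := mem_inter.1 hy
  obtain ⟨u, hu, rfl⟩ := mem_image.1 hx'
  obtain ⟨v, hv, rfl⟩ := mem_image.1 hy'
  exact h _ hx _ hy (by simpa using hu) (by simpa using hv)

theorem stmt19 (m n : ℕ) (hm : 0 < m) (hn : 0 < n)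
    (hm6 : m % 6 = 1 ∨ m % 6 = 5) (hn6 : n % 6 = 3) (hne : (m, n) ≠ (1, 9)) :
    ∃ F : Finset (Finset (ZMod m × ZMod n)), OOSPC m n 3 1 1 F ∧ Regular m n 1 3 F := by
  have : NeZero m := ⟨hm.ne'⟩
  have : NeZero n := ⟨hn.ne'⟩
  have hm3 : Nat.Coprime 3 m := by
    rw [Nat.Prime.coprime_iff_not_dvd Nat.prime_three]
    omega
  obtain ⟨F, hcard, huniq, hcov⟩ := (hasTripleCover_zmod_prod_zmod hm6 hn6 hne).exists_family
    ((threeTorsionIn_zmod (n := n) (s := n / 3) (by omega) (by omega)).zmod_prod hm3)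
  refine ⟨F, ⟨hcard, ?_, ?_⟩, ?_⟩
  · intro X hX g hg
    refine card_inter_image_add_le_one fun x hx y hy hx' hy' => ?_
    by_contra hxy
    have := (huniq X hX X hX x hx y hy _ hx' _ hy' hxy (by abel)).2
    exact hg (sub_eq_self.1 this.symm)
  · intro X hX Y hY hXY g
    refine card_inter_image_add_le_one fun x hx y hy hx' hy' => ?_
    by_contra hxy
    exact hXY (huniq X hX Y hY x hx y hy _ hx' _ hy' hxy (by abel)).1
  · ext p
    have hp : (1 • p.1 = 0 ∧ 3 • p.2 = 0) ↔ 3 • p = 0 := by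
      rw [Prod.ext_iff, one_smul, Prod.smul_fst, Prod.smul_snd, Prod.fst_zero, Prod.snd_zero,
        ZMod.three_nsmul_eq_zero_iff hm3]
    rw [Set.mem_ofPred_eq, hp, ← not_iff_not, ← ne_eq (3 • p), hcov p, Set.mem_insert_iff,
      leave, Set.mem_ofPred_eq]
    push Not
    tauto
end
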